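/- Let u be a stable regular solution of −Δ_p u = f(u) in the unit ball B₁ ⊂ ℝⁿ, with f ∈ C¹(ℝ), and let η be a Lipschitz function with compact support in B₁. Then ∫_{B₁} 2|∇u|^p r η_r η dx − p ∫_{B₁} r u_r |∇u|^{p−2} ∇u·∇(η²) dx + (n−p) ∫_{B₁} |∇u|^p η² dx ≤ ∫_{B₁} r² u_r² ( |∇u|^{p−2} |∇η|² + (p−2) |∇u|^{p−4} (∇η·∇u)² ) dx, where ∇η denotes the almost-everywhere defined gradient of η and η_r = (x/|x|)·∇η. -/

import Mathlib

open MeasureTheory Metric Set Filter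
open scoped RealInnerProductSpace

noncomputable section

abbrev Euc (n : ℕ) := EuclideanSpace ℝ (Fin n)

/-- `u` is a regular solution of `−Δ_p u = f(u)` in the open set `U ⊆ ℝⁿ`:
`u ∈ C¹(U)`, `f ∘ u ∈ L^∞(U)`, and the equation holds in the weak sense against
all `C¹` test functions with compact support in `U`. -/
def IsRegularSolution (n : ℕ) (p : ℝ) (U : Set (Euc n)) (f : ℝ → ℝ) (u : Euc n → ℝ) : Prop :=
  ContDiffOn ℝ 1 u U ∧
  (∃ C : ℝ, ∀ x ∈ U, |f (u x)| ≤ C) ∧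
  ∀ ξ : Euc n → ℝ, ContDiff ℝ 1 ξ → HasCompactSupport ξ → tsupport ξ ⊆ U →
    ∫ x in U, ‖gradient u x‖ ^ (p - 2) * ⟪gradient u x, gradient ξ x⟫
      = ∫ x in U, f (u x) * ξ x

/-- `u` is a stable regular solution of `−Δ_p u = f(u)` in `U`: the second variation of the
energy is nonnegative on all Lipschitz test functions with compact support in `U`. -/
def IsStableRegularSolution (n : ℕ) (p : ℝ) (U : Set (Euc n)) (f : ℝ → ℝ)
    (u : Euc n → ℝ) : Prop :=
  IsRegularSolution n p U f u ∧
  ∀ ξ : Euc n → ℝ, (∃ K, LipschitzWith K ξ) → HasCompactSupport ξ → tsupport ξ ⊆ U →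
    0 ≤ (∫ x in U ∩ {y | 0 < ‖gradient u y‖},
          (‖gradient u x‖ ^ (p - 2) * ‖gradient ξ x‖ ^ 2
            + (p - 2) * ‖gradient u x‖ ^ (p - 4) * ⟪gradient u x, gradient ξ x⟫ ^ 2))
        - ∫ x in U, deriv f (u x) * ξ x ^ 2

/-- The radial derivative `u_r(x) = (x/|x|)·∇u(x)` (junk value `0` at `x = 0`). -/
def radialDeriv {n : ℕ} (u : Euc n → ℝ) (x : Euc n) : ℝ := ⟪x, gradient u x⟫ / ‖x‖

/-- The dimension condition (★): `n < p + 4p/(p−1)` if `p ≥ 2`, and `n < 5p` if `1 < p < 2`. -/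
def DimensionCondition (n : ℕ) (p : ℝ) : Prop :=
  (2 ≤ p → (n : ℝ) < p + 4 * p / (p - 1)) ∧ (p < 2 → (n : ℝ) < 5 * p)

section Preparation

open Topology Asymptotics

theorem abs_sub_taylor_two_le {s : Set ℝ} (hs : Convex ℝ s) {F f f' : ℝ → ℝ} {c ε : ℝ}
    (hF : ∀ y ∈ s, HasDerivAt F (f y) y) (hf : ∀ y ∈ s, HasDerivAt f (f' y) y)
    (hc : ∀ y ∈ s, |f' y - c| ≤ ε) {a b : ℝ} (ha : a ∈ s) (hb : b ∈ s) :
    |F b - F a - f a * (b - a) - c / 2 * (b - a) ^ 2| ≤ ε * (b - a) ^ 2 := by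
  have hε : 0 ≤ ε := (abs_nonneg _).trans (hc a ha)
  have hsub : uIcc a b ⊆ s := by
    rw [← segment_eq_uIcc]; exact hs.segment_subset ha hb
  have h1 : ∀ y ∈ uIcc a b, |f y - f a - c * (y - a)| ≤ ε * |b - a| := by
    intro y hy
    have := hs.norm_image_sub_le_of_norm_hasDerivWithin_le (f := fun z => f z - c * z)
      (f' := fun z => f' z - c) (C := ε) (x := a) (y := y)
      (fun z hz => by
        refine (HasDerivAt.congr_deriv ((hf z hz).sub ((hasDerivAt_id z).const_mul c))
          (by simp)).hasDerivWithinAt)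
      (fun z hz => by simpa using hc z hz) ha (hsub hy)
    simp only [Real.norm_eq_abs] at this
    calc |f y - f a - c * (y - a)| = |f y - c * y - (f a - c * a)| := by congr 1; ring
      _ ≤ ε * |y - a| := this
      _ ≤ ε * |b - a| := mul_le_mul_of_nonneg_left (abs_sub_left_of_mem_uIcc hy) hε
  have h2 := (convex_uIcc a b).norm_image_sub_le_of_norm_hasDerivWithin_le
      (f := fun z => F z - f a * (z - a) - c / 2 * (z - a) ^ 2)
      (f' := fun z => f z - f a - c * (z - a)) (C := ε * |b - a|) (x := a) (y := b)
      (fun z hz => by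
        have h := ((hF z (hsub hz)).sub (((hasDerivAt_id z).sub_const a).const_mul (f a))).sub
          ((((hasDerivAt_id z).sub_const a).pow 2).const_mul (c / 2))
        refine (HasDerivAt.congr_deriv h ?_).hasDerivWithinAt
        simp; ring)
      (fun z hz => by simpa using h1 z hz) left_mem_uIcc right_mem_uIcc
  simp only [Real.norm_eq_abs] at h2
  calc _ = |F b - f a * (b - a) - c / 2 * (b - a) ^ 2 -
        (F a - f a * (a - a) - c / 2 * (a - a) ^ 2)| := by congr 1; ring
    _ ≤ _ := h2
    _ = _ := by rw [mul_assoc, abs_mul_abs_self]; ring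

theorem isLittleO_one_add_rpow (q : ℝ) :
    (fun y : ℝ => (1 + y) ^ q - 1 - q * y - q * (q - 1) / 2 * y ^ 2) =o[𝓝 0] fun y => y ^ 2 := by
  rw [isLittleO_iff]
  intro ε hε
  have hcont : ContinuousAt (fun y : ℝ => q * (q - 1) * (1 + y) ^ (q - 2)) 0 := by
    refine continuousAt_const.mul (ContinuousAt.rpow_const (by fun_prop) (Or.inl (by norm_num)))
  have h1 := hcont.eventually (Metric.ball_mem_nhds _ hε)
  have h2 : ∀ᶠ y : ℝ in 𝓝 0, -1 < y := lt_mem_nhds (by norm_num)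
  obtain ⟨r, hr, hball⟩ := Metric.eventually_nhds_iff_ball.1 (h1.and h2)
  filter_upwards [Metric.ball_mem_nhds _ hr] with y hy
  have := abs_sub_taylor_two_le (convex_ball (0 : ℝ) r) (F := fun y => (1 + y) ^ q)
    (f := fun y => q * (1 + y) ^ (q - 1)) (f' := fun y => q * (q - 1) * (1 + y) ^ (q - 2))
    (c := q * (q - 1)) (ε := ε)
    (fun y hy => by
      have h := ((hasDerivAt_id y).const_add 1).rpow_const (p := q)
        (Or.inl (by have := (hball y hy).2; simp; linarith))
      simpa using h)
    (fun y hy => by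
      have h := (((hasDerivAt_id y).const_add 1).rpow_const (p := q - 1)
        (Or.inl (by have := (hball y hy).2; simp; linarith))).const_mul q
      refine h.congr_deriv ?_
      simp; ring_nf)
    (fun y hy => by
      have := (hball y hy).1
      rw [Real.dist_eq] at this
      simpa using this.le)
    (Metric.mem_ball_self hr) hy
  simpa using this

/-- Uniformly along `L`, one has `A = 1 + T a + T² b + o(T²)` with bounded coefficients. -/
structure QuadExpansion {Y : Type*} (L : Filter Y) (T A a b : Y → ℝ) : Prop where
  fst : a =O[L] fun _ => (1 : ℝ)
  snd : b =O[L] fun _ => (1 : ℝ)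
  rem : (fun y => A y - (1 + T y * a y + T y ^ 2 * b y)) =o[L] fun y => T y ^ 2

namespace QuadExpansion

variable {Y : Type*} {L : Filter Y} {T A A' a a' b b' : Y → ℝ}

theorem poly (T : Y → ℝ) (ha : a =O[L] fun _ => (1 : ℝ)) (hb : b =O[L] fun _ => (1 : ℝ)) :
    QuadExpansion L T (fun y => 1 + T y * a y + T y ^ 2 * b y) a b :=
  ⟨ha, hb, by simp⟩

theorem isBigO_sub_one (h : QuadExpansion L T A a b) :
    (fun y => A y - 1 - T y * a y) =O[L] fun y => T y ^ 2 := by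
  have h1 : (fun y => T y ^ 2 * b y) =O[L] fun y => T y ^ 2 := by
    simpa using (isBigO_refl (fun y => T y ^ 2) L).mul h.snd
  refine (h.rem.isBigO.add h1).congr_left fun y => by ring

theorem isBigO_sq (hT : Tendsto T L (𝓝 0)) : (fun y => T y ^ 2) =O[L] T := by
  have : (fun y => T y * T y) =O[L] fun y => 1 * T y :=
    (hT.isBigO_one ℝ).mul (isBigO_refl T L)
  simpa [sq] using this

theorem isBigO_sub (hT : Tendsto T L (𝓝 0)) (h : QuadExpansion L T A a b) :
    (fun y => A y - 1) =O[L] T := by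
  have h2 : (fun y => T y * a y) =O[L] T := by
    simpa using (isBigO_refl T L).mul h.fst
  refine (((h.isBigO_sub_one).trans (isBigO_sq hT)).add h2).congr_left fun y => by ring

theorem mul (hT : Tendsto T L (𝓝 0)) (h : QuadExpansion L T A a b)
    (h' : QuadExpansion L T A' a' b') :
    QuadExpansion L T (fun y => A y * A' y) (fun y => a y + a' y)
      (fun y => b y + b' y + a y * a' y) := by
  have hT1 : T =O[L] fun _ => (1 : ℝ) := hT.isBigO_one ℝ
  have hA : A' =O[L] fun _ => (1 : ℝ) := by
    refine (((h'.isBigO_sub hT).trans hT1).add (isBigO_refl (fun _ => (1 : ℝ)) L)).congr_left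
      fun y => by ring
  have hm {u v : Y → ℝ} (hu : u =O[L] fun _ => (1 : ℝ)) (hv : v =O[L] fun _ => (1 : ℝ)) :
      (fun y => u y * v y) =O[L] fun _ => (1 : ℝ) := by simpa using hu.mul hv
  refine ⟨h.fst.add h'.fst, (h.snd.add h'.snd).add (hm h.fst h'.fst), ?_⟩
  have e1 : (fun y => (A y - (1 + T y * a y + T y ^ 2 * b y)) * A' y) =o[L] fun y => T y ^ 2 := by
    simpa using h.rem.mul_isBigO hA
  have hB : (fun y => 1 + T y * a y + T y ^ 2 * b y) =O[L] fun _ => (1 : ℝ) := by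
    refine ((isBigO_refl (fun _ => (1 : ℝ)) L).add (hm hT1 h.fst)).add ?_
    simpa [sq] using hm (hm hT1 hT1) h.snd
  have e2 : (fun y => (1 + T y * a y + T y ^ 2 * b y) *
      (A' y - (1 + T y * a' y + T y ^ 2 * b' y))) =o[L] fun y => T y ^ 2 := by
    simpa using hB.mul_isLittleO h'.rem
  have e3 : (fun y => (T y ^ 2 * T y) *
      (a y * b' y + a' y * b y + T y * (b y * b' y))) =o[L] fun y => T y ^ 2 := by
    have h1 : (fun y => T y ^ 2 * T y) =o[L] fun y => T y ^ 2 := by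
      simpa using (isBigO_refl (fun y => T y ^ 2) L).mul_isLittleO
        ((isLittleO_one_iff ℝ).2 hT)
    simpa using h1.mul_isBigO (((hm h.fst h'.snd).add (hm h'.fst h.snd)).add
      (hm hT1 (hm h.snd h'.snd)))
  refine ((e1.add e2).add e3).congr_left fun y => by ring

theorem rpow (hT : Tendsto T L (𝓝 0)) (h : QuadExpansion L T A a b) (q : ℝ) :
    QuadExpansion L T (fun y => A y ^ q) (fun y => q * a y)
      (fun y => q * b y + q * (q - 1) / 2 * a y ^ 2) := by
  have hT1 : T =O[L] fun _ => (1 : ℝ) := hT.isBigO_one ℝ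
  have h0 := h.isBigO_sub hT
  have ha2 : (fun y => a y ^ 2) =O[L] fun _ => (1 : ℝ) := by simpa [sq] using h.fst.mul h.fst
  refine ⟨h.fst.const_mul_left q, (h.snd.const_mul_left q).add (ha2.const_mul_left _), ?_⟩
  have e1 : (fun y => (1 + (A y - 1)) ^ q - 1 - q * (A y - 1) - q * (q - 1) / 2 * (A y - 1) ^ 2)
      =o[L] fun y => T y ^ 2 :=
    ((isLittleO_one_add_rpow q).comp_tendsto (h0.trans_tendsto hT)).trans_isBigO (h0.pow 2)
  have e2 := h.rem.const_mul_left q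
  have e3 : (fun y => (A y - 1 - T y * a y) * (A y - 1 + T y * a y)) =o[L] fun y => T y ^ 2 := by
    have hTa : (fun y => T y * a y) =O[L] T := by
      simpa using (isBigO_refl T L).mul h.fst
    have : (fun y => A y - 1 + T y * a y) =o[L] fun _ => (1 : ℝ) :=
      (h0.add hTa).trans_isLittleO ((isLittleO_one_iff ℝ).2 hT)
    simpa using (h.isBigO_sub_one).mul_isLittleO this
  refine ((e1.add e2).add (e3.const_mul_left (q * (q - 1) / 2))).congr_left fun y => ?_
  rw [add_sub_cancel]
  ring

theorem congr_coeff (h : QuadExpansion L T A a b) (ha : a = a') (hb : b = b') :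
    QuadExpansion L T A a' b' := ha ▸ hb ▸ h

end QuadExpansion

section Bregman

theorem exists_pos_le_one_add_rpow {p : ℝ} (hp : 1 < p) {ε : ℝ} (hε : 0 < ε) :
    ∃ ρ > 0, ∀ α κ : ℝ, α ^ 2 ≤ κ → κ ≤ ρ ^ 2 →
      (1 - ε) / 2 * (κ + (p - 2) * α ^ 2) ≤ 1 / p * ((1 + (2 * α + κ)) ^ (p / 2) - 1) - α := by
  have hp0 : 0 < p := by linarith
  obtain ⟨c, hc0, hc1, hcp⟩ : ∃ c : ℝ, 0 < c ∧ c ≤ 1 ∧ c ≤ p - 1 :=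
    ⟨min 1 (p - 1), lt_min one_pos (by linarith), min_le_left _ _, min_le_right _ _⟩
  have hE : 0 < p * (ε * c) / 72 := by positivity
  obtain ⟨r, hr, hR⟩ := Metric.eventually_nhds_iff_ball.1
    ((isLittleO_iff.1 (isLittleO_one_add_rpow (p / 2))) hE)
  obtain ⟨ρ, hρ, hρ1, hρr, hρc⟩ : ∃ ρ : ℝ, 0 < ρ ∧ ρ ≤ 1 ∧ ρ ≤ r / 4 ∧
      ρ ≤ ε * c / (8 * (|p - 2| + 1)) :=
    ⟨min 1 (min (r / 4) (ε * c / (8 * (|p - 2| + 1)))),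
      lt_min one_pos (lt_min (by positivity) (by positivity)), min_le_left _ _,
      (min_le_right _ _).trans (min_le_left _ _), (min_le_right _ _).trans (min_le_right _ _)⟩
  refine ⟨ρ, hρ, fun α κ hακ hκρ => ?_⟩
  have hκ0 : 0 ≤ κ := (sq_nonneg α).trans hακ
  have hαρ : |α| ≤ ρ := abs_le_of_sq_le_sq (hακ.trans hκρ) hρ.le
  have hκρ' : κ ≤ ρ := by nlinarith
  obtain ⟨hα1, hα2⟩ := abs_le.1 hαρ
  have hx : |2 * α + κ| < r := by rw [abs_lt]; constructor <;> linarith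
  have h := hR (2 * α + κ) (by simpa using hx)
  simp only [Real.norm_eq_abs, abs_pow, sq_abs] at h
  have h := (abs_le.1 h).1
  have hx2 : (2 * α + κ) ^ 2 ≤ 9 * κ := by nlinarith
  have hlow : c * κ ≤ κ + (p - 2) * α ^ 2 := by
    rcases le_total 2 p with h2 | h2
    · nlinarith [sq_nonneg α]
    · nlinarith [sq_nonneg α]
  rw [le_div_iff₀ (by positivity)] at hρc
  have hq : |(p - 2) / 8 * (κ * (4 * α + κ))| ≤ 5 / 64 * (ε * c * κ) := by
    have h5 : |κ * (4 * α + κ)| ≤ 5 * ρ * κ := by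
      rw [abs_mul, abs_of_nonneg hκ0, mul_comm]
      refine mul_le_mul_of_nonneg_right (abs_le.2 ⟨?_, ?_⟩) hκ0 <;> linarith
    rw [abs_mul, abs_div, abs_of_pos (by norm_num : (0 : ℝ) < 8)]
    calc |p - 2| / 8 * |κ * (4 * α + κ)| ≤ |p - 2| / 8 * (5 * ρ * κ) := by gcongr
      _ ≤ 5 / 64 * (ε * c * κ) := by nlinarith [mul_nonneg hρ.le hκ0, abs_nonneg (p - 2)]
  have hq := (abs_le.1 hq).1
  have key : 1 / p * ((1 + (2 * α + κ)) ^ (p / 2) - 1) ≥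
      (2 * α + κ) / 2 + (p - 2) / 8 * (2 * α + κ) ^ 2 - ε * c / 72 * (2 * α + κ) ^ 2 := by
    have e : (2 * α + κ) / 2 + (p - 2) / 8 * (2 * α + κ) ^ 2 - ε * c / 72 * (2 * α + κ) ^ 2 =
      1 / p * (p / 2 * (2 * α + κ) + p / 2 * (p / 2 - 1) / 2 * (2 * α + κ) ^ 2
        - p * (ε * c) / 72 * (2 * α + κ) ^ 2) := by field_simp; ring
    rw [e]
    exact mul_le_mul_of_nonneg_left (by linarith) (by positivity)
  have hεc : 0 < ε * c := by positivity
  nlinarith [mul_le_mul_of_nonneg_left hx2 hεc.le, mul_le_mul_of_nonneg_left hlow hε.le,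
    mul_nonneg hεc.le hκ0]

variable {E : Type*} [NormedAddCommGroup E] [InnerProductSpace ℝ E]

/-- The Bregman divergence of `z ↦ ‖z‖ ^ p / p`. -/
def pBregman (p : ℝ) (a b : E) : ℝ :=
  ‖b‖ ^ p / p - ‖a‖ ^ p / p - ‖a‖ ^ (p - 2) * ⟪a, b - a⟫

/-- The Hessian quadratic form of `z ↦ ‖z‖ ^ p / p` at `a`. -/
def pHessian (p : ℝ) (a h : E) : ℝ :=
  ‖a‖ ^ (p - 2) * ‖h‖ ^ 2 + (p - 2) * ‖a‖ ^ (p - 4) * ⟪a, h⟫ ^ 2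

theorem pBregman_nonneg {p : ℝ} (hp : 1 < p) (a b : E) : 0 ≤ pBregman p a b := by
  have hp0 : 0 < p := by linarith
  unfold pBregman
  rcases eq_or_ne a 0 with rfl | ha
  · simp [Real.zero_rpow hp0.ne']; positivity
  have hn : 0 < ‖a‖ := norm_pos_iff.2 ha
  have hconj : p.HolderConjugate (p / (p - 1)) := Real.HolderConjugate.conjExponent hp
  have hy := Real.young_inequality_of_nonneg (norm_nonneg b)
    (Real.rpow_nonneg hn.le (p - 1)) hconj
  rw [← Real.rpow_mul hn.le, mul_div_cancel₀ _ (by linarith)] at hy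
  have e1 : ‖a‖ ^ (p - 1) = ‖a‖ ^ (p - 2) * ‖a‖ := by
    rw [← Real.rpow_add_one hn.ne']; ring_nf
  have e2 : ‖a‖ ^ p = ‖a‖ ^ (p - 2) * ‖a‖ ^ 2 := by
    rw [← Real.rpow_natCast, ← Real.rpow_add hn]; norm_num
  have hin : ‖a‖ ^ (p - 2) * ⟪a, b⟫ ≤ ‖a‖ ^ (p - 2) * (‖a‖ * ‖b‖) :=
    mul_le_mul_of_nonneg_left (real_inner_le_norm a b) (Real.rpow_nonneg hn.le _)
  rw [inner_sub_right, real_inner_self_eq_norm_sq]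
  have e3 : ‖a‖ ^ p / (p / (p - 1)) = ‖a‖ ^ p - ‖a‖ ^ p / p := by
    field_simp
  rw [e3, e1] at hy
  nlinarith

theorem pHessian_nonneg {p : ℝ} (hp : 1 < p) {a : E} (ha : a ≠ 0) (h : E) :
    0 ≤ pHessian p a h := by
  have hn : 0 < ‖a‖ := norm_pos_iff.2 ha
  unfold pHessian
  have e2 : ‖a‖ ^ (p - 2) = ‖a‖ ^ (p - 4) * ‖a‖ ^ 2 := by
    rw [← Real.rpow_natCast, ← Real.rpow_add hn]; congr 1; push_cast; ring
  have h1 : ⟪a, h⟫ ^ 2 ≤ ‖a‖ ^ 2 * ‖h‖ ^ 2 := by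
    rw [← mul_pow, ← sq_abs]; gcongr; exact abs_real_inner_le_norm a h
  have h2 : 0 < ‖a‖ ^ (p - 4) := Real.rpow_pos_of_pos hn _
  have h3 : 0 ≤ ‖a‖ ^ 2 * ‖h‖ ^ 2 + (p - 2) * ⟪a, h⟫ ^ 2 := by nlinarith [sq_nonneg ⟪a, h⟫]
  rw [e2]
  nlinarith

theorem pHessian_smul (p c : ℝ) (a h : E) : pHessian p a (c • h) = c ^ 2 * pHessian p a h := by
  simp only [pHessian, norm_smul, inner_smul_right, mul_pow, Real.norm_eq_abs, sq_abs]
  ring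

theorem exists_pos_pHessian_le_pBregman {p : ℝ} (hp : 1 < p) {ε : ℝ} (hε : 0 < ε) :
    ∃ ρ > 0, ∀ a b : E, a ≠ 0 → ‖b - a‖ ≤ ρ * ‖a‖ →
      (1 - ε) * pHessian p a (b - a) ≤ 2 * pBregman p a b := by
  obtain ⟨ρ, hρ, H⟩ := exists_pos_le_one_add_rpow hp hε
  refine ⟨ρ, hρ, fun a b ha hh => ?_⟩
  have hn : 0 < ‖a‖ := norm_pos_iff.2 ha
  have hp0 : 0 < p := by linarith
  obtain ⟨h, rfl⟩ : ∃ h, b = a + h := ⟨b - a, by abel⟩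
  rw [add_sub_cancel_left] at hh ⊢
  have hαk : (⟪a, h⟫ / ‖a‖ ^ 2) ^ 2 ≤ ‖h‖ ^ 2 / ‖a‖ ^ 2 := by
    have h1 : ⟪a, h⟫ ^ 2 ≤ ‖a‖ ^ 2 * ‖h‖ ^ 2 := by
      rw [← mul_pow, ← sq_abs]; gcongr; exact abs_real_inner_le_norm a h
    rw [div_pow, div_le_div_iff₀ (by positivity) (by positivity)]
    calc _ ≤ ‖a‖ ^ 2 * ‖h‖ ^ 2 * ‖a‖ ^ 2 := by gcongr
      _ = _ := by ring
  have hk : ‖h‖ ^ 2 / ‖a‖ ^ 2 ≤ ρ ^ 2 := by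
    rw [div_le_iff₀ (by positivity), ← mul_pow]; gcongr
  have key := H _ _ hαk hk
  have e0 : ‖a + h‖ ^ 2 = ‖a‖ ^ 2 * (1 + (2 * (⟪a, h⟫ / ‖a‖ ^ 2) + ‖h‖ ^ 2 / ‖a‖ ^ 2)) := by
    rw [norm_add_sq_real]; field_simp; ring
  have e1 : ‖a + h‖ ^ p =
      ‖a‖ ^ p * (1 + (2 * (⟪a, h⟫ / ‖a‖ ^ 2) + ‖h‖ ^ 2 / ‖a‖ ^ 2)) ^ (p / 2) := by
    have hsq (z : E) : ‖z‖ ^ p = (‖z‖ ^ 2) ^ (p / 2) := by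
      rw [← Real.rpow_natCast, ← Real.rpow_mul (norm_nonneg _)]; congr 1; push_cast; ring
    rw [hsq (a + h), e0, Real.mul_rpow (by positivity), ← hsq]
    rw [← mul_nonneg_iff_of_pos_left (pow_pos hn 2), ← e0]; positivity
  have e2 : ‖a‖ ^ (p - 2) = ‖a‖ ^ p / ‖a‖ ^ 2 := by
    rw [← Real.rpow_natCast, ← Real.rpow_sub hn]; norm_num
  have e4 : ‖a‖ ^ (p - 4) = ‖a‖ ^ p / ‖a‖ ^ 4 := by
    rw [← Real.rpow_natCast, ← Real.rpow_sub hn]; norm_num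
  have hN : 0 < ‖a‖ ^ p := Real.rpow_pos_of_pos hn _
  simp only [pHessian, pBregman]
  rw [e1, e2, e4, add_sub_cancel_left]
  have key := mul_le_mul_of_nonneg_left key (by positivity : 0 ≤ 2 * ‖a‖ ^ p)
  refine (le_of_eq ?_).trans (key.trans (le_of_eq ?_))
  · field_simp
  · field_simp

end Bregman

section RadialMap

variable {n : ℕ} {η : Euc n → ℝ}

theorem HasCompactSupport.exists_norm_le {X F : Type*} [TopologicalSpace X]
    [SeminormedAddCommGroup F] {g : X → F} (h : HasCompactSupport g) (hg : Continuous g) :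
    ∃ M, 0 < M ∧ ∀ x, ‖g x‖ ≤ M := by
  obtain ⟨C, hC⟩ := h.exists_bound_of_continuous hg
  exact ⟨max C 1, lt_max_of_lt_right one_pos, fun x => (hC x).trans (le_max_left _ _)⟩

theorem ContDiff.continuous_gradient {u : Euc n → ℝ} (hu : ContDiff ℝ 1 u) :
    Continuous (gradient u) :=
  (InnerProductSpace.toDual ℝ (Euc n)).symm.continuous.comp (hu.continuous_fderiv one_ne_zero)

theorem ContDiff.hasGradientAt {u : Euc n → ℝ} (hu : ContDiff ℝ 1 u) (x : Euc n) :
    HasGradientAt u (gradient u x) x :=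
  (hu.differentiable one_ne_zero x).hasGradientAt

theorem support_gradient_subset (u : Euc n → ℝ) :
    Function.support (gradient u) ⊆ tsupport u := by
  intro x hx
  by_contra h
  have : u =ᶠ[𝓝 x] fun _ => 0 := notMem_tsupport_iff_eventuallyEq.1 h
  exact hx (by rw [this.gradient_eq]; simp)

theorem gradient_eq_zero_of_notMem_tsupport {u : Euc n → ℝ} {x : Euc n} (h : x ∉ tsupport u) :
    gradient u x = 0 := by
  by_contra hx
  exact h (support_gradient_subset u hx)

theorem HasCompactSupport.gradient {u : Euc n → ℝ} (hu : HasCompactSupport u) :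
    HasCompactSupport (gradient u) :=
  hu.mono' (support_gradient_subset u)

/-- The factor `s` for which `x ↦ s x • x` has Jacobian affine in `t`. -/
def radScale (η : Euc n → ℝ) (t : ℝ) (x : Euc n) : ℝ := (1 + n * t * η x) ^ ((1 : ℝ) / n)

/-- The radial deformation of space with profile `η`. -/
def radMap (η : Euc n → ℝ) (t : ℝ) (x : Euc n) : Euc n := radScale η t x • x

/-- The factor `σ` in `∇ (radScale η t) = t σ ∇η`. -/
def radSlope (η : Euc n → ℝ) (t : ℝ) (x : Euc n) : ℝ := (1 + n * t * η x) ^ ((1 : ℝ) / n - 1)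

/-- The Jacobian of `radMap η t` is `1 + t * radDiv η`. -/
def radDiv (η : Euc n → ℝ) (x : Euc n) : ℝ := n * η x + ⟪gradient η x, x⟫

/-- The derivative of `radMap η t`. -/
def radMapDeriv (η : Euc n → ℝ) (t : ℝ) (x : Euc n) : Euc n →L[ℝ] Euc n :=
  radScale η t x • ContinuousLinearMap.id ℝ (Euc n) +
    ((t * radSlope η t x) • innerSL ℝ (gradient η x)).smulRight x

theorem radMapDeriv_apply (t : ℝ) (x h : Euc n) : radMapDeriv η t x h =
    radScale η t x • h + (t * radSlope η t x * ⟪gradient η x, h⟫) • x := by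
  simp [radMapDeriv]

theorem radScale_pos {t : ℝ} {x : Euc n} (hP : 0 < 1 + n * t * η x) : 0 < radScale η t x :=
  Real.rpow_pos_of_pos hP _

theorem radSlope_pos {t : ℝ} {x : Euc n} (hP : 0 < 1 + n * t * η x) : 0 < radSlope η t x :=
  Real.rpow_pos_of_pos hP _

theorem radScale_eq {t : ℝ} {x : Euc n} (hP : 0 < 1 + n * t * η x) :
    radScale η t x = radSlope η t x * (1 + n * t * η x) := by
  rw [radScale, radSlope, ← Real.rpow_add_one hP.ne']; congr 1; ring

theorem radScale_pow (hn : 0 < n) {t : ℝ} {x : Euc n} (hP : 0 < 1 + n * t * η x) :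
    radScale η t x ^ n = 1 + n * t * η x := by
  rw [radScale, ← Real.rpow_natCast, ← Real.rpow_mul hP.le, one_div,
    inv_mul_cancel₀ (by positivity), Real.rpow_one]

theorem det_radMapDeriv (hn : 0 < n) {t : ℝ} {x : Euc n} (hP : 0 < 1 + n * t * η x) :
    (radMapDeriv η t x).det = 1 + t * radDiv η x := by
  have hs := radScale_pos hP
  have e : ((radMapDeriv η t x : Euc n →L[ℝ] Euc n) : Euc n →ₗ[ℝ] Euc n) = radScale η t x •
      LinearMap.transvection (((t * radSlope η t x / radScale η t x) •
        innerSL ℝ (gradient η x) : Euc n →L[ℝ] ℝ) : Euc n →ₗ[ℝ] ℝ) x := by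
    ext1 h
    simp only [ContinuousLinearMap.coe_coe, radMapDeriv_apply, LinearMap.smul_apply,
      LinearMap.transvection.apply, smul_add, smul_smul, _root_.smul_apply,
      innerSL_apply_apply, smul_eq_mul]
    congr 2
    field_simp
  rw [ContinuousLinearMap.det, e, LinearMap.det_smul, LinearMap.transvection.det,
    finrank_euclideanSpace_fin, radScale_pow hn hP]
  simp only [ContinuousLinearMap.coe_coe, _root_.smul_apply,
      innerSL_apply_apply, smul_eq_mul, radDiv]
  rw [radScale_eq hP]
  have := radSlope_pos hP
  field_simp
  ring

theorem hasFDerivAt_radScale (hn : 0 < n) (hη : ContDiff ℝ 1 η) {t : ℝ} {x : Euc n}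
    (hP : 0 < 1 + n * t * η x) :
    HasFDerivAt (radScale η t) ((t * radSlope η t x) • innerSL ℝ (gradient η x)) x := by
  have h1 : HasFDerivAt η (innerSL ℝ (gradient η x)) x := (hη.hasGradientAt x).hasFDerivAt
  have h2 := ((h1.const_mul (n * t : ℝ)).const_add 1).rpow_const (p := (1 : ℝ) / n) (Or.inl hP.ne')
  refine h2.congr_fderiv ?_
  have : (n : ℝ) ≠ 0 := by positivity
  rw [smul_smul, radSlope]
  congr 1
  field_simp

theorem hasFDerivAt_radMap (hn : 0 < n) (hη : ContDiff ℝ 1 η) {t : ℝ} {x : Euc n}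
    (hP : 0 < 1 + n * t * η x) : HasFDerivAt (radMap η t) (radMapDeriv η t x) x :=
  (hasFDerivAt_radScale hn hη hP).smul (hasFDerivAt_id x)

theorem contDiff_radMap (hη : ContDiff ℝ 1 η) {t : ℝ} (hP : ∀ x, 0 < 1 + n * t * η x) :
    ContDiff ℝ 1 (radMap η t) := by
  have : ContDiff ℝ 1 (radScale η t) :=
    ContDiff.rpow_const_of_ne (contDiff_const.add (contDiff_const.mul hη)) fun x => (hP x).ne'
  exact this.smul contDiff_id

/-- The uniform-in-space filter at time zero. -/
abbrev uniformAtZero (E : Type*) : Filter (ℝ × E) := 𝓝 0 ×ˢ ⊤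

theorem tendsto_fst_uniformAtZero (E : Type*) :
    Tendsto (Prod.fst : ℝ × E → ℝ) (uniformAtZero E) (𝓝 0) := tendsto_fst

theorem eventually_uniformAtZero {E : Type*} {P : ℝ × E → Prop} :
    (∀ᶠ y in uniformAtZero E, P y) ↔ ∀ᶠ t in 𝓝 0, ∀ x, P (t, x) := by
  rw [uniformAtZero, ← principal_univ, eventually_prod_principal_iff]; simp

theorem isBigO_one_of_bound {E : Type*} {L : Filter E} {g : E → ℝ} {M : ℝ} (h : ∀ x, ‖g x‖ ≤ M) :
    g =O[L] fun _ => (1 : ℝ) :=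
  IsBigO.of_bound M (Eventually.of_forall fun x => by simpa using h x)

theorem quadExpansion_rpow (hη : Continuous η) (hηc : HasCompactSupport η) (q : ℝ) :
    QuadExpansion (uniformAtZero (Euc n)) Prod.fst (fun y => (1 + n * y.1 * η y.2) ^ q)
      (fun y => q * (n * η y.2)) (fun y => q * (q - 1) / 2 * (n * η y.2) ^ 2) := by
  obtain ⟨M, -, hM⟩ := hηc.exists_norm_le hη
  have h1 : (fun y : ℝ × Euc n => n * η y.2) =O[uniformAtZero (Euc n)] fun _ => (1 : ℝ) :=
    (isBigO_one_of_bound fun y : ℝ × Euc n => hM y.2).const_mul_left _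
  have := (QuadExpansion.poly Prod.fst h1 (isBigO_zero _ _)).rpow (tendsto_fst_uniformAtZero _) q
  simp only [mul_zero, add_zero, zero_add] at this
  refine ⟨this.fst, this.snd, this.rem.congr_left fun y => ?_⟩
  congr 2
  ring

theorem eventually_one_add_mul_pos {g : Euc n → ℝ} {M : ℝ} (hg : ∀ x, ‖g x‖ ≤ M) :
    ∀ᶠ t : ℝ in 𝓝 0, ∀ x, 0 < 1 + t * g x := by
  have hM0 : 0 ≤ M := (norm_nonneg _).trans (hg 0)
  have : ∀ᶠ t : ℝ in 𝓝 0, |t| < 1 / (M + 1) := by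
    have := Metric.ball_mem_nhds (0 : ℝ) (by positivity : 0 < 1 / (M + 1))
    filter_upwards [this] with t ht
    simpa using ht
  filter_upwards [this] with t ht x
  rw [lt_div_iff₀ (by positivity)] at ht
  have h1 : |t * g x| ≤ |t| * M := by
    rw [abs_mul]; exact mul_le_mul_of_nonneg_left (hg x) (abs_nonneg t)
  have := (abs_le.1 h1).1
  nlinarith [abs_nonneg t]

theorem eventually_radBase_pos (hη : Continuous η) (hηc : HasCompactSupport η) :
    ∀ᶠ t : ℝ in 𝓝 0, ∀ x, 0 < 1 + n * t * η x := by
  obtain ⟨M, -, hM⟩ := hηc.exists_norm_le hη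
  filter_upwards [eventually_one_add_mul_pos (g := fun x => n * η x) (M := n * M)
    (fun x => by simpa using mul_le_mul_of_nonneg_left (hM x) (Nat.cast_nonneg n))] with t ht x
  simpa [mul_assoc, mul_left_comm] using ht x

theorem radDiv_bound (hη : ContDiff ℝ 1 η) (hηc : HasCompactSupport η) :
    ∃ M, 0 < M ∧ ∀ x, ‖radDiv η x‖ ≤ M := by
  have hc : Continuous (radDiv η) := by
    have := hη.continuous_gradient
    have := hη.continuous
    unfold radDiv
    fun_prop
  have hs : HasCompactSupport (radDiv η) := by
    refine hηc.mono' fun x hx => ?_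
    by_contra h
    exact hx (by simp [radDiv, image_eq_zero_of_notMem_tsupport h,
      gradient_eq_zero_of_notMem_tsupport h])
  exact hs.exists_norm_le hc

theorem radScale_eq_one {t : ℝ} {x : Euc n} (h : η x = 0) : radScale η t x = 1 := by
  simp [radScale, h]

theorem radMap_eq_self {t : ℝ} {x : Euc n} (h : η x = 0) : radMap η t x = x := by
  simp [radMap, radScale_eq_one h]

/-- `radScale η t - 1 - t η = O(t²)`, uniformly in space. -/
theorem isBigO_radScale (hη : Continuous η) (hηc : HasCompactSupport η) (hn : 0 < n) :
    (fun y : ℝ × Euc n => radScale η y.1 y.2 - 1 - y.1 * η y.2) =O[uniformAtZero (Euc n)]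
      fun y => y.1 ^ 2 := by
  refine (quadExpansion_rpow hη hηc ((1 : ℝ) / n)).isBigO_sub_one.congr_left fun y => ?_
  have : (n : ℝ) ≠ 0 := by positivity
  simp only [radScale]
  field_simp

theorem eventually_norm_radMapDeriv_sub_id_le (hη : ContDiff ℝ 1 η) (hηc : HasCompactSupport η)
    {δ : ℝ} (hδ : 0 < δ) : ∀ᶠ t : ℝ in 𝓝 0, ∀ x,
      ‖radMapDeriv η t x - ContinuousLinearMap.id ℝ (Euc n)‖ ≤ δ := by
  have hT := tendsto_fst_uniformAtZero (Euc n)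
  have h1 : Tendsto (fun y : ℝ × Euc n => radScale η y.1 y.2 - 1) (uniformAtZero (Euc n)) (𝓝 0) :=
    ((quadExpansion_rpow hη.continuous hηc ((1 : ℝ) / n)).isBigO_sub hT).trans_tendsto hT
  have h2 : Tendsto (fun y : ℝ × Euc n => radSlope η y.1 y.2 - 1) (uniformAtZero (Euc n)) (𝓝 0) :=
    ((quadExpansion_rpow hη.continuous hηc ((1 : ℝ) / n - 1)).isBigO_sub hT).trans_tendsto hT
  obtain ⟨M, hM0, hM⟩ : ∃ M, 0 < M ∧ ∀ x, ‖‖x‖ • gradient η x‖ ≤ M := by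
    have hs : HasCompactSupport fun x => ‖x‖ • gradient η x := HasCompactSupport.intro hηc
      fun x hx => by rw [gradient_eq_zero_of_notMem_tsupport hx, smul_zero]
    exact hs.exists_norm_le (continuous_norm.smul hη.continuous_gradient)
  have e1 := eventually_uniformAtZero.1 (h1.eventually (Metric.ball_mem_nhds _
    (half_pos hδ)))
  have e2 := eventually_uniformAtZero.1 (h2.eventually (Metric.ball_mem_nhds _ one_pos))
  have e3 : ∀ᶠ t : ℝ in 𝓝 0, |t| < δ / (4 * M) := by
    have := Metric.ball_mem_nhds (0 : ℝ) (by positivity : 0 < δ / (4 * M))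
    filter_upwards [this] with t ht
    simpa using ht
  filter_upwards [e1, e2, e3] with t h1 h2 h3 x
  have h1 := h1 x
  have h2 := h2 x
  simp only [Real.dist_eq, sub_zero] at h1 h2
  have h4 : |radSlope η t x| ≤ 2 := by
    rw [abs_lt] at h2; rw [abs_le]; constructor <;> linarith
  rw [lt_div_iff₀ (by positivity)] at h3
  refine ContinuousLinearMap.opNorm_le_bound _ hδ.le fun h => ?_
  have e : (radMapDeriv η t x - ContinuousLinearMap.id ℝ (Euc n)) h =
      (radScale η t x - 1) • h + (t * radSlope η t x * ⟪gradient η x, h⟫) • x := by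
    rw [_root_.sub_apply, radMapDeriv_apply, sub_smul]; simp; abel
  rw [e]
  refine (norm_add_le _ _).trans ?_
  rw [norm_smul, norm_smul, norm_mul, norm_mul]
  simp only [Real.norm_eq_abs]
  have hM := hM x
  rw [norm_smul, norm_norm] at hM
  have h5 : |⟪gradient η x, h⟫| * ‖x‖ ≤ M * ‖h‖ := by
    calc _ ≤ ‖gradient η x‖ * ‖h‖ * ‖x‖ := by gcongr; exact abs_real_inner_le_norm _ _
      _ = ‖x‖ * ‖gradient η x‖ * ‖h‖ := by ring
      _ ≤ _ := by gcongr
  calc _ ≤ δ / 2 * ‖h‖ + |t| * 2 * (|⟪gradient η x, h⟫| * ‖x‖) := by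
        rw [mul_assoc (|t| * _)]
        gcongr
    _ ≤ δ / 2 * ‖h‖ + |t| * 2 * (M * ‖h‖) := by gcongr
    _ ≤ δ * ‖h‖ := by nlinarith [norm_nonneg h]

theorem eventually_exists_homeomorph (hη : ContDiff ℝ 1 η) (hηc : HasCompactSupport η)
    (hn : 0 < n) : ∀ᶠ t : ℝ in 𝓝 0, ∃ Φ : Euc n ≃ₜ Euc n, ⇑Φ = radMap η t ∧
      ContDiff ℝ 1 Φ.symm := by
  obtain ⟨M, -, hM⟩ := radDiv_bound hη hηc
  filter_upwards [eventually_norm_radMapDeriv_sub_id_le hη hηc one_half_pos,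
    eventually_radBase_pos hη.continuous hηc, eventually_one_add_mul_pos hM] with t h1 hP hJ
  have happ : ApproximatesLinearOn (radMap η t)
      ((ContinuousLinearEquiv.refl ℝ (Euc n) : Euc n ≃L[ℝ] Euc n) : Euc n →L[ℝ] Euc n) univ
      (1 / 2) := by
    intro x _ y _
    have := convex_univ.norm_image_sub_le_of_norm_hasFDerivWithin_le
      (f := fun x => radMap η t x - x)
      (fun z _ => ((hasFDerivAt_radMap hn hη (hP z)).sub (hasFDerivAt_id z)).hasFDerivWithinAt)
      (fun z _ => h1 z) (mem_univ y) (mem_univ x)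
    refine (le_of_eq ?_).trans (this.trans (le_of_eq ?_))
    · congr 1
      simp
      abel
    · norm_num
  have hc : Subsingleton (Euc n) ∨ (1 / 2 : NNReal) <
      ‖((ContinuousLinearEquiv.refl ℝ (Euc n)).symm : Euc n →L[ℝ] Euc n)‖₊⁻¹ := by
    right
    have : Nonempty (Fin n) := ⟨⟨0, hn⟩⟩
    have : ‖((ContinuousLinearEquiv.refl ℝ (Euc n)).symm : Euc n →L[ℝ] Euc n)‖₊ = 1 :=
      NNReal.eq ContinuousLinearMap.norm_id
    rw [this, inv_one, ← NNReal.coe_lt_coe]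
    norm_num
  refine ⟨happ.toHomeomorph _ hc, rfl, ?_⟩
  have hdet : ∀ x, (radMapDeriv η t x).det ≠ 0 := fun x => by
    rw [det_radMapDeriv hn (hP x)]; exact (hJ x).ne'
  refine Homeomorph.contDiff_symm _
    (f₀' := fun x => (radMapDeriv η t x).toContinuousLinearEquivOfDetNeZero (hdet x)) ?_
    (contDiff_radMap hη hP)
  intro x
  rw [ContinuousLinearMap.coe_toContinuousLinearEquivOfDetNeZero]
  exact hasFDerivAt_radMap hn hη (hP x)

end RadialMap

section DeformedFunction

variable {n : ℕ} {η u v : Euc n → ℝ} {t p : ℝ}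

theorem radMap_mem_tsupport_compl {Φ : Euc n ≃ₜ Euc n} (hΦ : ⇑Φ = radMap η t) {x : Euc n}
    (hx : x ∉ tsupport η) : Φ.symm x = x := by
  rw [Homeomorph.symm_apply_eq, hΦ, radMap_eq_self (image_eq_zero_of_notMem_tsupport hx)]

theorem inner_gradient_eq_of_comp (hn : 0 < n) (hη : ContDiff ℝ 1 η) (hv : ContDiff ℝ 1 v)
    (huv : u = v ∘ radMap η t) {y : Euc n} (hP : 0 < 1 + n * t * η y) (h : Euc n) :
    ⟪gradient u y, h⟫ = ⟪gradient v (radMap η t y), radMapDeriv η t y h⟫ := by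
  have h1 := (hv.hasGradientAt (radMap η t y)).hasFDerivAt.comp y (hasFDerivAt_radMap hn hη hP)
  rw [huv, inner_gradient_left, h1.fderiv]
  simp

theorem gradient_eq_of_comp (hn : 0 < n) (hη : ContDiff ℝ 1 η) (hv : ContDiff ℝ 1 v)
    (huv : u = v ∘ radMap η t) {y : Euc n} (hP : 0 < 1 + n * t * η y) :
    (radScale η t y * (1 + t * radDiv η y)) • gradient v (radMap η t y) =
      (1 + t * radDiv η y) • gradient u y - (t * ⟪gradient u y, y⟫) • gradient η y := by
  have key := inner_gradient_eq_of_comp hn hη hv huv hP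
  set ζ := gradient v (radMap η t y)
  have h1 : gradient u y = radScale η t y • ζ +
      (t * radSlope η t y * ⟪ζ, y⟫) • gradient η y := by
    refine ext_inner_right ℝ fun h => ?_
    rw [key h, radMapDeriv_apply]
    simp only [inner_add_left, inner_add_right, inner_smul_left, inner_smul_right,
      RCLike.conj_to_real]
    ring
  have h2 : ⟪gradient u y, y⟫ = radSlope η t y * (1 + t * radDiv η y) * ⟪ζ, y⟫ := by
    rw [key y, radMapDeriv_apply]
    simp only [inner_add_right, inner_smul_right, radDiv]
    rw [radScale_eq hP]
    ring
  rw [h2, h1]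
  module

theorem norm_gradient_sub_le_of_comp (hn : 0 < n) (hη : ContDiff ℝ 1 η) (hv : ContDiff ℝ 1 v)
    (huv : u = v ∘ radMap η t) {y : Euc n} (hP : 0 < 1 + n * t * η y) {δ : ℝ} (hδ : δ ≤ 1 / 2)
    (hL : ‖radMapDeriv η t y - ContinuousLinearMap.id ℝ (Euc n)‖ ≤ δ) :
    ‖gradient v (radMap η t y) - gradient u y‖ ≤ 2 * δ * ‖gradient u y‖ := by
  have key := inner_gradient_eq_of_comp hn hη hv huv hP
  set ζ := gradient v (radMap η t y)
  have hδ0 : 0 ≤ δ := (norm_nonneg _).trans hL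
  have h1 : ‖gradient u y - ζ‖ ≤ δ * ‖ζ‖ := by
    set d := gradient u y - ζ with hd
    have h2 : ‖d‖ * ‖d‖ ≤ δ * ‖ζ‖ * ‖d‖ := by
      rw [← real_inner_self_eq_norm_mul_norm]
      have : ⟪d, d⟫ = ⟪ζ, (radMapDeriv η t y - ContinuousLinearMap.id ℝ (Euc n)) d⟫ := by
        rw [_root_.sub_apply, inner_sub_right ζ, ← key d, ContinuousLinearMap.id_apply,
          ← inner_sub_left]
      rw [this]
      calc _ ≤ ‖ζ‖ * ‖(radMapDeriv η t y - ContinuousLinearMap.id ℝ (Euc n)) d‖ :=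
            real_inner_le_norm _ _
        _ ≤ ‖ζ‖ * (δ * ‖d‖) := by
            gcongr; exact ContinuousLinearMap.le_of_opNorm_le _ hL _
        _ = _ := by ring
    by_contra hlt
    push Not at hlt
    nlinarith [norm_nonneg ζ, mul_nonneg hδ0 (norm_nonneg ζ)]
  have h3 : ‖ζ‖ ≤ ‖gradient u y‖ + ‖gradient u y - ζ‖ := by
    have := norm_sub_norm_le ζ (gradient u y)
    rw [norm_sub_rev] at this; linarith
  have h4 : ‖ζ‖ ≤ 2 * ‖gradient u y‖ := by nlinarith [norm_nonneg ζ]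
  rw [norm_sub_rev]
  nlinarith

theorem integral_comp_symm_eq (hn : 0 < n) (hη : ContDiff ℝ 1 η)
    (hP : ∀ x, 0 < 1 + n * t * η x) (hJ : ∀ x, 0 < 1 + t * radDiv η x)
    {Φ : Euc n ≃ₜ Euc n} (hΦ : ⇑Φ = radMap η t) (g : Euc n → ℝ) :
    ∫ x, g x = ∫ y, (1 + t * radDiv η y) * g (radMap η t y) := by
  have := integral_image_eq_integral_abs_det_fderiv_smul volume MeasurableSet.univ
    (fun x _ => (hasFDerivAt_radMap hn hη (hP x)).hasFDerivWithinAt)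
    (hΦ ▸ Φ.injective.injOn) g
  rw [image_univ, ← hΦ, Φ.surjective.range_eq, setIntegral_univ, setIntegral_univ, hΦ] at this
  rw [this]
  congr 1 with y
  rw [det_radMapDeriv hn (hP y), abs_of_pos (hJ y), smul_eq_mul]

theorem uniform_taylor_one (hu : ContDiff ℝ 1 u) (huc : HasCompactSupport u) {ε : ℝ} (hε : 0 < ε) :
    ∃ ρ > 0, ∀ x y : Euc n, ‖y - x‖ < ρ →
      |u y - u x - ⟪gradient u x, y - x⟫| ≤ ε * ‖y - x‖ := by
  have hUC := huc.gradient.uniformContinuous_of_continuous hu.continuous_gradient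
  obtain ⟨ρ, hρ, H⟩ := Metric.uniformContinuous_iff.1 hUC ε hε
  refine ⟨ρ, hρ, fun x y hxy => ?_⟩
  have := (convex_ball x ρ).norm_image_sub_le_of_norm_hasFDerivWithin_le
    (f := fun z => u z - innerSL ℝ (gradient u x) z)
    (f' := fun z => innerSL ℝ (gradient u z) - innerSL ℝ (gradient u x)) (C := ε)
    (fun z _ => ((hu.hasGradientAt z).hasFDerivAt.sub
      (innerSL ℝ (gradient u x)).hasFDerivAt).hasFDerivWithinAt)
    (fun z hz => by
      rw [← map_sub, innerSL_apply_norm, ← dist_eq_norm]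
      exact (H (mem_ball.1 hz)).le)
    (mem_ball_self hρ) (by rwa [mem_ball, dist_eq_norm])
  refine (le_of_eq ?_).trans this
  rw [Real.norm_eq_abs]
  congr 1
  simp [inner_sub_right]
  ring

end DeformedFunction

section Competitor

variable {n : ℕ} {η u v : Euc n → ℝ} {t p : ℝ}

/-- The integrand of the inner second variation of the `p`-energy along the radial
deformation with profile value `a` and profile gradient `v`, at a point `x` where the function
has gradient `z`. -/
def scaleDensity (n : ℕ) (p : ℝ) (x z v : Euc n) (a : ℝ) : ℝ :=
  ‖z‖ ^ p * ((p - n) * a ^ 2 - 2 * a * ⟪x, v⟫) +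
    2 * p * a * ⟪x, z⟫ * ‖z‖ ^ (p - 2) * ⟪z, v⟫ +
    ⟪x, z⟫ ^ 2 * (‖z‖ ^ (p - 2) * ‖v‖ ^ 2 + (p - 2) * ‖z‖ ^ (p - 4) * ⟪v, z⟫ ^ 2)

/-- The relative squared length `1 + t a + t² b` of `(1 + t m) z - t ⟪z, x⟫ v`. -/
def radRatio (m : ℝ) (x z v : Euc n) (t : ℝ) : ℝ :=
  1 + t * (2 * (m - ⟪x, z⟫ * ⟪z, v⟫ / ‖z‖ ^ 2)) +
    t ^ 2 * (m ^ 2 - 2 * m * (⟪x, z⟫ * ⟪z, v⟫ / ‖z‖ ^ 2) + ⟪x, z⟫ ^ 2 * ‖v‖ ^ 2 / ‖z‖ ^ 2)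

theorem norm_sq_eq_radRatio {x z v : Euc n} (hz : z ≠ 0) (m t : ℝ) :
    ‖(1 + t * m) • z - (t * ⟪z, x⟫) • v‖ ^ 2 = ‖z‖ ^ 2 * radRatio m x z v t := by
  have : 0 < ‖z‖ := norm_pos_iff.2 hz
  rw [norm_sub_sq_real, norm_smul, norm_smul, mul_pow, mul_pow, Real.norm_eq_abs, Real.norm_eq_abs,
    sq_abs, sq_abs, inner_smul_left, inner_smul_right, RCLike.conj_to_real, radRatio,
    real_inner_comm x z]
  field_simp
  ring

theorem norm_rpow_mul_eq (hp : 0 < p) {P J : ℝ} (hP : 0 < P) (hJ : 0 < J) {m : ℝ}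
    (hJm : J = 1 + t * m) {x z v ζ : Euc n}
    (h : (P ^ ((1 : ℝ) / n) * J) • ζ = J • z - (t * ⟪z, x⟫) • v) :
    J * ‖ζ‖ ^ p = ‖z‖ ^ p * (P ^ (-p / n) * (J ^ (1 - p) * radRatio m x z v t ^ (p / 2))) := by
  have hs : 0 < P ^ ((1 : ℝ) / n) := Real.rpow_pos_of_pos hP _
  rcases eq_or_ne z 0 with rfl | hz
  · rw [smul_zero, inner_zero_left, mul_zero, zero_smul, sub_zero] at h
    have : ζ = 0 := (smul_eq_zero.1 h).resolve_left (mul_pos hs hJ).ne'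
    simp [this, Real.zero_rpow hp.ne']
  have hz' : 0 < ‖z‖ := norm_pos_iff.2 hz
  have h1 := norm_sq_eq_radRatio (x := x) (v := v) hz m t
  have hsq (w : Euc n) : ‖w‖ ^ p = (‖w‖ ^ 2) ^ (p / 2) := by
    rw [← Real.rpow_natCast, ← Real.rpow_mul (norm_nonneg _)]; congr 1; push_cast; ring
  have hR : 0 ≤ radRatio m x z v t := by
    rw [← mul_nonneg_iff_of_pos_left (pow_pos hz' 2), ← h1]; positivity
  have h2 : (P ^ ((1 : ℝ) / n) * J) ^ p * ‖ζ‖ ^ p = ‖z‖ ^ p * radRatio m x z v t ^ (p / 2) := by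
    rw [hsq z, ← Real.mul_rpow (by positivity) hR, ← h1, ← hsq, ← hJm, ← h, norm_smul,
      Real.norm_of_nonneg (by positivity), Real.mul_rpow (by positivity) (norm_nonneg _)]
  rw [Real.mul_rpow hs.le hJ.le, ← Real.rpow_mul hP.le] at h2
  have h3 : P ^ (-p / n) * P ^ ((1 : ℝ) / n * p) = 1 := by
    rw [← Real.rpow_add hP, show -p / n + (1 : ℝ) / n * p = 0 by ring, Real.rpow_zero]
  have h4 : J ^ (1 - p) * J ^ p = J := by
    rw [← Real.rpow_add hJ]; simp
  calc J * ‖ζ‖ ^ p = (P ^ (-p / n) * P ^ ((1 : ℝ) / n * p)) * (J ^ (1 - p) * J ^ p) * ‖ζ‖ ^ p := by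
        rw [h3, h4, one_mul]
    _ = P ^ (-p / n) * J ^ (1 - p) * (P ^ ((1 : ℝ) / n * p) * J ^ p * ‖ζ‖ ^ p) := by ring
    _ = _ := by rw [h2]; ring

theorem norm_rpow_mul_eq_scaleDensity {x z v : Euc n} {a m : ℝ} (hm : m = n * a + ⟪v, x⟫)
    (hp : 0 < p) :
    ‖z‖ ^ p * (p / 2 * ((p + n) * a ^ 2 - 2 * m * a + 2 * p * a * (⟪x, z⟫ * ⟪z, v⟫ / ‖z‖ ^ 2) +
      ⟪x, z⟫ ^ 2 * ‖v‖ ^ 2 / ‖z‖ ^ 2 + (p - 2) * (⟪x, z⟫ * ⟪z, v⟫ / ‖z‖ ^ 2) ^ 2)) =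
    p / 2 * scaleDensity n p x z v a := by
  rcases eq_or_ne z 0 with rfl | hz
  · simp [scaleDensity, Real.zero_rpow hp.ne']
  have hn : 0 < ‖z‖ := norm_pos_iff.2 hz
  have e2 : ‖z‖ ^ (p - 2) = ‖z‖ ^ p / ‖z‖ ^ 2 := by
    rw [← Real.rpow_natCast, ← Real.rpow_sub hn]; norm_num
  have e4 : ‖z‖ ^ (p - 4) = ‖z‖ ^ p / ‖z‖ ^ 4 := by
    rw [← Real.rpow_natCast, ← Real.rpow_sub hn]; norm_num
  rw [scaleDensity, e2, e4, hm, real_inner_comm v z, real_inner_comm x v]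
  field_simp
  ring

theorem exists_bound_of_isBigO_uniformAtZero {E : Type*} {a : E → ℝ}
    (h : (fun y : ℝ × E => a y.2) =O[uniformAtZero E] fun _ => (1 : ℝ)) : ∃ C, ∀ x, ‖a x‖ ≤ C := by
  obtain ⟨C, hC⟩ := h.bound
  obtain ⟨t, ht⟩ := (eventually_uniformAtZero.1 hC).exists
  exact ⟨C, fun x => by simpa using ht x⟩

theorem eventually_abs_integral_sub_le {w : Euc n → ℝ} (hw : Integrable w) (hw0 : 0 ≤ w)
    {A : ℝ → Euc n → ℝ} {a b : Euc n → ℝ} (hA : QuadExpansion (uniformAtZero (Euc n)) Prod.fst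
      (fun y => A y.1 y.2) (fun y => a y.2) (fun y => b y.2))
    (ha : AEStronglyMeasurable a) (hb : AEStronglyMeasurable b)
    (hwA : ∀ᶠ t in 𝓝 0, Integrable fun x => w x * A t x) {ε : ℝ} (hε : 0 < ε) :
    ∀ᶠ t in 𝓝 0, |(∫ x, w x * A t x) - (∫ x, w x) - t * (∫ x, w x * a x) -
      t ^ 2 * ∫ x, w x * b x| ≤ ε * t ^ 2 := by
  obtain ⟨Ca, hCa⟩ := exists_bound_of_isBigO_uniformAtZero hA.fst
  obtain ⟨Cb, hCb⟩ := exists_bound_of_isBigO_uniformAtZero hA.snd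
  have hI : 0 ≤ ∫ x, w x := integral_nonneg hw0
  have hδ : 0 < ε / ((∫ x, w x) + 1) := by positivity
  filter_upwards [hwA, eventually_uniformAtZero.1 (isLittleO_iff.1 hA.rem hδ)] with t h1 h2
  have ia : Integrable fun x => w x * a x := hw.mul_bdd (c := Ca) ha (Eventually.of_forall hCa)
  have ib : Integrable fun x => w x * b x := hw.mul_bdd (c := Cb) hb (Eventually.of_forall hCb)
  have e : (∫ x, w x * A t x) - (∫ x, w x) - t * (∫ x, w x * a x) - t ^ 2 * ∫ x, w x * b x =
      ∫ x, w x * (A t x - (1 + t * a x + t ^ 2 * b x)) := by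
    have i1 : Integrable fun x => w x * A t x - w x := h1.sub hw
    have i2 : Integrable fun x => w x * A t x - w x - t * (w x * a x) := i1.sub (ia.const_mul t)
    rw [← integral_const_mul, ← integral_const_mul, ← integral_sub h1 hw,
      ← integral_sub i1 (ia.const_mul t), ← integral_sub i2 (ib.const_mul _)]
    congr 1 with x
    ring
  rw [e, ← Real.norm_eq_abs]
  have h3 : ∀ x, ‖w x * (A t x - (1 + t * a x + t ^ 2 * b x))‖ ≤
      (ε / ((∫ x, w x) + 1) * t ^ 2) * w x := by
    intro x
    have := h2 x
    rw [norm_mul, Real.norm_of_nonneg (hw0 x), mul_comm]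
    refine mul_le_mul_of_nonneg_right (this.trans_eq ?_) (hw0 x)
    simp
  refine (norm_integral_le_of_norm_le (hw.const_mul _) (Eventually.of_forall h3)).trans ?_
  rw [integral_const_mul]
  have : ε / ((∫ x, w x) + 1) * (∫ x, w x) ≤ ε := by
    rw [div_mul_eq_mul_div, div_le_iff₀ (by positivity)]; nlinarith
  nlinarith [sq_nonneg t]

/-- The relative density of the `p`-energy of the deformed function. -/
def energyRatio (n : ℕ) (p : ℝ) (η u : Euc n → ℝ) (t : ℝ) (y : Euc n) : ℝ :=
  (1 + n * t * η y) ^ (-p / n) * ((1 + t * radDiv η y) ^ (1 - p) *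
    radRatio (radDiv η y) y (gradient u y) (gradient η y) t ^ (p / 2))

theorem quadExpansion_energyRatio (hn : 0 < n) (hη : ContDiff ℝ 1 η) (hηc : HasCompactSupport η)
    (u : Euc n → ℝ) :
    QuadExpansion (uniformAtZero (Euc n)) Prod.fst (fun y => energyRatio n p η u y.1 y.2)
      (fun y => radDiv η y.2 - p * η y.2 - p * (⟪y.2, gradient u y.2⟫ *
        ⟪gradient u y.2, gradient η y.2⟫ / ‖gradient u y.2‖ ^ 2))
      (fun y => p / 2 * ((p + n) * η y.2 ^ 2 - 2 * radDiv η y.2 * η y.2 + 2 * p * η y.2 *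
          (⟪y.2, gradient u y.2⟫ * ⟪gradient u y.2, gradient η y.2⟫ / ‖gradient u y.2‖ ^ 2) +
        ⟪y.2, gradient u y.2⟫ ^ 2 * ‖gradient η y.2‖ ^ 2 / ‖gradient u y.2‖ ^ 2 +
        (p - 2) * (⟪y.2, gradient u y.2⟫ * ⟪gradient u y.2, gradient η y.2⟫ /
          ‖gradient u y.2‖ ^ 2) ^ 2)) := by
  have hT := tendsto_fst_uniformAtZero (Euc n)
  have hn' : (n : ℝ) ≠ 0 := by positivity
  obtain ⟨Cm, -, hCm⟩ := radDiv_bound hη hηc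
  obtain ⟨M, hM0, hM⟩ : ∃ M, 0 < M ∧ ∀ x, ‖‖x‖ • gradient η x‖ ≤ M := by
    have hs : HasCompactSupport fun x => ‖x‖ • gradient η x := HasCompactSupport.intro hηc
      fun x hx => by rw [gradient_eq_zero_of_notMem_tsupport hx, smul_zero]
    exact hs.exists_norm_le (continuous_norm.smul hη.continuous_gradient)
  have bm : (fun y : ℝ × Euc n => radDiv η y.2) =O[uniformAtZero (Euc n)] fun _ => (1 : ℝ) :=
    isBigO_one_of_bound fun y : ℝ × Euc n => hCm y.2
  have bβ : (fun y : ℝ × Euc n => ⟪y.2, gradient u y.2⟫ * ⟪gradient u y.2, gradient η y.2⟫ /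
      ‖gradient u y.2‖ ^ 2) =O[uniformAtZero (Euc n)] fun _ => (1 : ℝ) := by
    refine isBigO_one_of_bound (M := M) fun y => ?_
    rw [norm_div, norm_mul, norm_pow, norm_norm]
    refine div_le_of_le_mul₀ (by positivity) hM0.le ?_
    have := hM y.2
    rw [norm_smul, norm_norm] at this
    calc _ ≤ (‖y.2‖ * ‖gradient u y.2‖) * (‖gradient u y.2‖ * ‖gradient η y.2‖) := by
          gcongr <;> exact norm_inner_le_norm _ _
      _ = (‖y.2‖ * ‖gradient η y.2‖) * ‖gradient u y.2‖ ^ 2 := by ring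
      _ ≤ _ := by gcongr
  have bκ : (fun y : ℝ × Euc n => ⟪y.2, gradient u y.2⟫ ^ 2 * ‖gradient η y.2‖ ^ 2 /
      ‖gradient u y.2‖ ^ 2) =O[uniformAtZero (Euc n)] fun _ => (1 : ℝ) := by
    refine isBigO_one_of_bound (M := M ^ 2) fun y => ?_
    rw [norm_div, norm_mul, norm_pow, norm_pow, norm_pow, norm_norm, norm_norm]
    refine div_le_of_le_mul₀ (by positivity) (by positivity) ?_
    have := hM y.2
    rw [norm_smul, norm_norm] at this
    calc _ ≤ (‖y.2‖ * ‖gradient u y.2‖) ^ 2 * ‖gradient η y.2‖ ^ 2 := by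
          gcongr; exact norm_inner_le_norm _ _
      _ = (‖y.2‖ * ‖gradient η y.2‖) ^ 2 * ‖gradient u y.2‖ ^ 2 := by ring
      _ ≤ _ := by gcongr
  have hmul {f g : ℝ × Euc n → ℝ} (hf : f =O[uniformAtZero (Euc n)] fun _ => (1 : ℝ))
      (hg : g =O[uniformAtZero (Euc n)] fun _ => (1 : ℝ)) :
      (fun y => f y * g y) =O[uniformAtZero (Euc n)] fun _ => (1 : ℝ) := by simpa using hf.mul hg
  have q1 := quadExpansion_rpow (n := n) hη.continuous hηc (-p / n)
  have q2 := (QuadExpansion.poly Prod.fst bm (isBigO_zero _ _)).rpow hT (1 - p)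
  simp only [mul_zero, add_zero, zero_add] at q2
  have q3 := (QuadExpansion.poly Prod.fst ((bm.sub bβ).const_mul_left 2)
    (((hmul bm bm).sub ((hmul bm bβ).const_mul_left 2)).add bκ)).rpow hT (p / 2)
  have q := q1.mul hT (q2.mul hT q3)
  refine QuadExpansion.congr_coeff (A := fun y => energyRatio n p η u y.1 y.2)
    ⟨q.fst, q.snd, q.rem.congr_left fun y => ?_⟩ (funext fun y => ?_) (funext fun y => ?_)
  · simp only [energyRatio, radRatio, sq (radDiv η y.2), mul_assoc]
  · field_simp
    ring
  · generalize ⟪y.2, gradient u y.2⟫ * ⟪gradient u y.2, gradient η y.2⟫ /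
          ‖gradient u y.2‖ ^ 2 = β
    generalize ⟪y.2, gradient u y.2⟫ ^ 2 * ‖gradient η y.2‖ ^ 2 / ‖gradient u y.2‖ ^ 2 = κ
    field_simp
    ring

end Competitor

section ExistsCompetitor

variable {n : ℕ} {η u : Euc n → ℝ} {p : ℝ}

theorem eventually_norm_radMap_sub_le (hη : Continuous η) (hηc : HasCompactSupport η)
    (hn : 0 < n) : ∃ K, 0 < K ∧ ∀ᶠ t : ℝ in 𝓝 0, ∀ y, ‖radMap η t y - y‖ ≤ K * |t| := by
  obtain ⟨M, hM0, hM⟩ := hηc.exists_norm_le hη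
  obtain ⟨R, hR0, hR⟩ := hηc.isBounded.exists_pos_norm_le
  obtain ⟨C, hC0, hC⟩ := (isBigO_radScale hη hηc hn).exists_pos
  refine ⟨(M + C) * R, by positivity, ?_⟩
  filter_upwards [eventually_uniformAtZero.1 hC.bound,
    Metric.ball_mem_nhds (0 : ℝ) one_pos] with t h1 h2 y
  by_cases hy : y ∈ tsupport η
  · have h1 := h1 y
    have h2 : |t| < 1 := by simpa using h2
    simp only [norm_pow, Real.norm_eq_abs] at h1
    have hMy : |η y| ≤ M := hM y
    have h3 : |radScale η t y - 1| ≤ (M + C) * |t| := by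
      calc _ = |(radScale η t y - 1 - t * η y) + t * η y| := by ring_nf
        _ ≤ C * |t| ^ 2 + |t| * |η y| := (abs_add_le _ _).trans (by rw [abs_mul]; gcongr)
        _ ≤ C * |t| + |t| * M := by gcongr; nlinarith [abs_nonneg t]
        _ = _ := by ring
    have e : radMap η t y - y = (radScale η t y - 1) • y := by rw [radMap, sub_smul, one_smul]
    rw [e, norm_smul, Real.norm_eq_abs]
    calc _ ≤ ((M + C) * |t|) * R := by gcongr; exact hR y hy
      _ = _ := by ring
  · rw [radMap_eq_self (image_eq_zero_of_notMem_tsupport hy), sub_self, norm_zero]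
    positivity

theorem eventually_abs_competitor_sub_le (hn : 0 < n) (hη : ContDiff ℝ 1 η)
    (hηc : HasCompactSupport η) (hu : ContDiff ℝ 1 u) (huc : HasCompactSupport u) {ε : ℝ}
    (hε : 0 < ε) : ∀ᶠ t : ℝ in 𝓝 0, ∀ y, |u y - u (radMap η t y) +
      t * (η (radMap η t y) * ⟪radMap η t y, gradient u (radMap η t y)⟫)| ≤ ε * |t| := by
  obtain ⟨K, hK0, hK⟩ := eventually_norm_radMap_sub_le hη.continuous hηc hn
  obtain ⟨ρ, hρ, hT⟩ := uniform_taylor_one hu huc (ε := ε / (3 * K)) (by positivity)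
  obtain ⟨C, hC0, hC⟩ := (isBigO_radScale hη.continuous hηc hn).exists_pos
  have hgc := hu.continuous_gradient
  have hWc : Continuous fun x => ⟪x, gradient u x⟫ := by fun_prop
  have hWs : HasCompactSupport fun x => ⟪x, gradient u x⟫ := HasCompactSupport.intro huc
      fun x hx => by rw [gradient_eq_zero_of_notMem_tsupport hx, inner_zero_right]
  obtain ⟨N, hN0, hN⟩ := hWs.exists_norm_le hWc
  have hUC := (hWs.mul_left (f := η)).uniformContinuous_of_continuous (hη.continuous.mul hWc)
  obtain ⟨ρ', hρ', hW⟩ := Metric.uniformContinuous_iff.1 hUC (ε / 3) (by positivity)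
  have small {c : ℝ} (hc : 0 < c) : ∀ᶠ t : ℝ in 𝓝 0, |t| < c := by
    filter_upwards [Metric.ball_mem_nhds (0 : ℝ) hc] with t ht
    simpa using ht
  filter_upwards [hK, eventually_uniformAtZero.1 hC.bound,
    small (show 0 < ρ / K by positivity), small (show 0 < ρ' / K by positivity),
    small (show 0 < ε / (3 * (C * N)) by positivity)] with t hK hC t1 t2 t3 y
  have hK := hK y
  rw [lt_div_iff₀ hK0, mul_comm] at t1 t2
  rw [lt_div_iff₀ (by positivity)] at t3
  have h1 := hT y (radMap η t y) (hK.trans_lt t1)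
  have h2 := hW (a := radMap η t y) (b := y) (by rw [dist_eq_norm]; exact hK.trans_lt t2)
  have h3 := hC y
  simp only [norm_pow, Real.norm_eq_abs] at h3
  rw [Real.dist_eq] at h2
  simp only [Pi.mul_apply] at h2
  set x := radMap η t y
  have e : x - y = (radScale η t y - 1) • y := by
    simp only [x]; rw [radMap, sub_smul, one_smul]
  have e1 : ⟪gradient u y, x - y⟫ = (radScale η t y - 1) * ⟪y, gradient u y⟫ := by
    rw [e, inner_smul_right, real_inner_comm]
  have h1' : |u x - u y - (radScale η t y - 1) * ⟪y, gradient u y⟫| ≤ ε / 3 * |t| := by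
    rw [← e1]
    refine h1.trans ?_
    calc _ ≤ ε / (3 * K) * (K * |t|) := by gcongr
      _ = _ := by field_simp
  have h2' : |t * (η x * ⟪x, gradient u x⟫ - η y * ⟪y, gradient u y⟫)| ≤ ε / 3 * |t| := by
    rw [abs_mul, mul_comm]; gcongr
  have h3' : |(radScale η t y - 1 - t * η y) * ⟪y, gradient u y⟫| ≤ ε / 3 * |t| := by
    rw [abs_mul]
    calc _ ≤ C * |t| ^ 2 * N := by gcongr; exact hN y
      _ = |t| * (C * N) * |t| := by ring
      _ ≤ _ := by gcongr; linarith
  rw [abs_le] at *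
  constructor <;> nlinarith

theorem forall_of_forall_apply {Φ : Euc n ≃ₜ Euc n} {P : Euc n → Prop} {g : Euc n → Euc n}
    (hΦ : ⇑Φ = g) (h : ∀ y, P (g y)) (x : Euc n) : P x := by
  rw [← Φ.apply_symm_apply x, hΦ]; exact h _

theorem eventually_norm_gradient_competitor_sub_le (hn : 0 < n) (hη : ContDiff ℝ 1 η)
    (hηc : HasCompactSupport η) (hu : ContDiff ℝ 1 u) (huc : HasCompactSupport u) {ε : ℝ}
    (hε : 0 < ε) : ∀ᶠ t : ℝ in 𝓝 0, ∀ v, ContDiff ℝ 1 v → u = v ∘ radMap η t →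
      ∀ y, ‖gradient v (radMap η t y) - gradient u (radMap η t y)‖ ≤ ε := by
  obtain ⟨K, hK0, hK⟩ := eventually_norm_radMap_sub_le hη.continuous hηc hn
  have hUC := huc.gradient.uniformContinuous_of_continuous hu.continuous_gradient
  obtain ⟨M, hM0, hM⟩ := huc.gradient.exists_norm_le hu.continuous_gradient
  obtain ⟨ρ, hρ, hW⟩ := Metric.uniformContinuous_iff.1 hUC (ε / 2) (by positivity)
  have hδ : 0 < min (1 / 2) (ε / (4 * M)) := by positivity
  have small {c : ℝ} (hc : 0 < c) : ∀ᶠ t : ℝ in 𝓝 0, |t| < c := by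
    filter_upwards [Metric.ball_mem_nhds (0 : ℝ) hc] with t ht
    simpa using ht
  filter_upwards [hK, small (show 0 < ρ / K by positivity),
    eventually_radBase_pos hη.continuous hηc,
    eventually_norm_radMapDeriv_sub_id_le hη hηc hδ] with t hK t1 hP hL v hv huv y
  rw [lt_div_iff₀ hK0, mul_comm] at t1
  have h1 := norm_gradient_sub_le_of_comp hn hη hv huv (hP y) (min_le_left _ _) (hL y)
  have h2 := hW (a := y) (b := radMap η t y) (by
    rw [dist_comm, dist_eq_norm]; exact (hK y).trans_lt t1)
  rw [dist_eq_norm] at h2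
  have h3 : 2 * min (1 / 2) (ε / (4 * M)) * ‖gradient u y‖ ≤ ε / 2 := by
    calc _ ≤ 2 * (ε / (4 * M)) * M := by gcongr; exacts [min_le_right _ _, hM y]
      _ = _ := by field_simp; norm_num
  calc _ = ‖(gradient v (radMap η t y) - gradient u y) +
        (gradient u y - gradient u (radMap η t y))‖ := by congr 1; abel
    _ ≤ _ := norm_add_le _ _
    _ ≤ _ := by linarith

theorem jacobian_mul_norm_gradient_rpow_eq (hn : 0 < n) (hp : 0 < p) (hη : ContDiff ℝ 1 η)
    {v : Euc n → ℝ} (hv : ContDiff ℝ 1 v) {t : ℝ} (huv : u = v ∘ radMap η t) {y : Euc n}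
    (hP : 0 < 1 + n * t * η y) (hJ : 0 < 1 + t * radDiv η y) :
    (1 + t * radDiv η y) * ‖gradient v (radMap η t y)‖ ^ p =
      ‖gradient u y‖ ^ p * energyRatio n p η u t y :=
  norm_rpow_mul_eq hp hP hJ rfl (gradient_eq_of_comp hn hη hv huv hP)

theorem exists_energy_expansion (hn : 0 < n) (hp : 1 < p) (hη : ContDiff ℝ 1 η)
    (hηc : HasCompactSupport η) (hu : ContDiff ℝ 1 u) (huc : HasCompactSupport u) :
    ∃ c : ℝ, ∀ ε > 0, ∀ᶠ t in 𝓝 0, ∀ v, ContDiff ℝ 1 v → u = v ∘ radMap η t →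
      |(∫ x, ‖gradient v x‖ ^ p / p) - (∫ x, ‖gradient u x‖ ^ p / p) - t * c -
        t ^ 2 / 2 * ∫ x, scaleDensity n p x (gradient u x) (gradient η x) (η x)| ≤ ε * t ^ 2 := by
  have hp0 : 0 < p := by linarith
  have hgc := hu.continuous_gradient
  have hηg := hη.continuous_gradient
  have hη0 := hη.continuous
  have hw : Continuous fun x => ‖gradient u x‖ ^ p :=
    hgc.norm.rpow_const fun _ => Or.inr hp0.le
  have hws : HasCompactSupport fun x => ‖gradient u x‖ ^ p :=
    HasCompactSupport.intro huc fun x hx => by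
      rw [gradient_eq_zero_of_notMem_tsupport hx, norm_zero, Real.zero_rpow hp0.ne']
  have mg : Measurable (gradient u) := hgc.measurable
  have mη : Measurable (gradient η) := hηg.measurable
  have mη0 : Measurable η := hη0.measurable
  have md : Measurable (radDiv η) := by unfold radDiv; fun_prop
  obtain ⟨M, -, hM⟩ := radDiv_bound hη hηc
  have hA := quadExpansion_energyRatio (p := p) hn hη hηc u
  have key : ∀ᶠ t in 𝓝 0, ∃ Φ : Euc n ≃ₜ Euc n, ⇑Φ = radMap η t ∧ ContDiff ℝ 1 (u ∘ Φ.symm) ∧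
      u = (u ∘ Φ.symm) ∘ radMap η t ∧ (∀ x, 0 < 1 + n * t * η x) ∧
      ∀ x, 0 < 1 + t * radDiv η x := by
    filter_upwards [eventually_exists_homeomorph hη hηc hn,
      eventually_radBase_pos hη.continuous hηc, eventually_one_add_mul_pos hM]
      with t ⟨Φ, hΦ, hΦs⟩ hP hJ
    exact ⟨Φ, hΦ, hu.comp hΦs, funext fun y => by simp [← hΦ], hP, hJ⟩
  have hwA : ∀ᶠ t in 𝓝 0, Integrable fun x => ‖gradient u x‖ ^ p * energyRatio n p η u t x := by
    filter_upwards [key] with t ⟨Φ, hΦ, hv, huv, hP, hJ⟩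
    refine Continuous.integrable_of_hasCompactSupport ?_ hws.mul_right
    have : (fun x => ‖gradient u x‖ ^ p * energyRatio n p η u t x) = fun y =>
        (1 + t * radDiv η y) * ‖gradient (u ∘ Φ.symm) (radMap η t y)‖ ^ p := funext fun y =>
      (jacobian_mul_norm_gradient_rpow_eq hn hp0 hη hv huv (hP y) (hJ y)).symm
    rw [this]
    have c1 : Continuous (radDiv η) := by unfold radDiv; fun_prop
    have c2 : Continuous fun y => ‖gradient (u ∘ Φ.symm) (radMap η t y)‖ ^ p :=
      (hv.continuous_gradient.comp (contDiff_radMap hη hP).continuous).norm.rpow_const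
        fun _ => Or.inr hp0.le
    fun_prop
  have ma : Measurable fun x => radDiv η x - p * η x - p * (⟪x, gradient u x⟫ *
        ⟪gradient u x, gradient η x⟫ / ‖gradient u x‖ ^ 2) := by fun_prop
  have mb : Measurable fun x => p / 2 * ((p + n) * η x ^ 2 - 2 * radDiv η x * η x + 2 * p * η x *
        (⟪x, gradient u x⟫ * ⟪gradient u x, gradient η x⟫ / ‖gradient u x‖ ^ 2) +
      ⟪x, gradient u x⟫ ^ 2 * ‖gradient η x‖ ^ 2 / ‖gradient u x‖ ^ 2 +
      (p - 2) * (⟪x, gradient u x⟫ * ⟪gradient u x, gradient η x⟫ / ‖gradient u x‖ ^ 2) ^ 2) := by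
    fun_prop
  refine ⟨(∫ x, ‖gradient u x‖ ^ p * (radDiv η x - p * η x - p * (⟪x, gradient u x⟫ *
        ⟪gradient u x, gradient η x⟫ / ‖gradient u x‖ ^ 2))) / p, fun ε hε => ?_⟩
  have hB := eventually_abs_integral_sub_le (hw.integrable_of_hasCompactSupport hws)
    (fun x => by positivity) hA ma.aestronglyMeasurable mb.aestronglyMeasurable hwA
    (mul_pos hε hp0)
  filter_upwards [key, hB] with t ⟨Φ, hΦ, _, _, hP, hJ⟩ h v hv huv
  have e1 : ∫ x, ‖gradient v x‖ ^ p = ∫ x, ‖gradient u x‖ ^ p * energyRatio n p η u t x := by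
    rw [integral_comp_symm_eq hn hη hP hJ hΦ fun x => ‖gradient v x‖ ^ p]
    congr 1 with y
    exact jacobian_mul_norm_gradient_rpow_eq hn hp0 hη hv huv (hP y) (hJ y)
  have e2 (x : Euc n) : ‖gradient u x‖ ^ p * (p / 2 *
      ((p + n) * η x ^ 2 - 2 * radDiv η x * η x + 2 * p * η x *
        (⟪x, gradient u x⟫ * ⟪gradient u x, gradient η x⟫ / ‖gradient u x‖ ^ 2) +
      ⟪x, gradient u x⟫ ^ 2 * ‖gradient η x‖ ^ 2 / ‖gradient u x‖ ^ 2 +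
      (p - 2) * (⟪x, gradient u x⟫ * ⟪gradient u x, gradient η x⟫ / ‖gradient u x‖ ^ 2) ^ 2)) =
      p / 2 * scaleDensity n p x (gradient u x) (gradient η x) (η x) :=
    norm_rpow_mul_eq_scaleDensity rfl hp0
  simp only [e2] at h
  rw [integral_const_mul, ← e1] at h
  rw [integral_div, integral_div]
  set a₁ := ∫ x, ‖gradient v x‖ ^ p
  set a₀ := ∫ x, ‖gradient u x‖ ^ p
  set Q := ∫ x, scaleDensity n p x (gradient u x) (gradient η x) (η x)
  rw [← mul_le_mul_iff_left₀ hp0]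
  refine (le_of_eq ?_).trans (h.trans_eq (by ring))
  rw [← abs_of_pos hp0, ← abs_mul, abs_of_pos hp0]
  congr 1
  field_simp

theorem exists_competitor (hn : 0 < n) (hp : 1 < p) (hη : ContDiff ℝ 1 η)
    (hηc : HasCompactSupport η) (hu : ContDiff ℝ 1 u) (huc : HasCompactSupport u) :
    ∃ c : ℝ, ∀ ε > 0, ∀ᶠ t in 𝓝 0, ∃ v, ContDiff ℝ 1 v ∧ (∀ x ∉ tsupport η, v x = u x) ∧
      (∀ x, |v x - u x + t * (η x * ⟪x, gradient u x⟫)| ≤ ε * |t|) ∧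
      (∀ x, ‖gradient v x - gradient u x‖ ≤ ε) ∧
      |(∫ x, ‖gradient v x‖ ^ p / p) - (∫ x, ‖gradient u x‖ ^ p / p) - t * c -
        t ^ 2 / 2 * ∫ x, scaleDensity n p x (gradient u x) (gradient η x) (η x)| ≤ ε * t ^ 2 ∧
      ∀ F : ℝ → ℝ, ∫ x, F (v x) = ∫ x, (1 + t * radDiv η x) * F (u x) := by
  obtain ⟨c, hc⟩ := exists_energy_expansion hn hp hη hηc hu huc
  obtain ⟨M, -, hM⟩ := radDiv_bound hη hηc
  refine ⟨c, fun ε hε => ?_⟩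
  filter_upwards [hc ε hε, eventually_exists_homeomorph hη hηc hn,
    eventually_radBase_pos hη.continuous hηc, eventually_one_add_mul_pos hM,
    eventually_abs_competitor_sub_le hn hη hηc hu huc hε,
    eventually_norm_gradient_competitor_sub_le hn hη hηc hu huc hε]
    with t hc ⟨Φ, hΦ, hΦs⟩ hP hJ h1 h2
  have hv : ContDiff ℝ 1 (u ∘ Φ.symm) := hu.comp hΦs
  have hvy : ∀ y, (u ∘ Φ.symm) (radMap η t y) = u y := fun y => by
    rw [← hΦ]; simp
  have huv : u = (u ∘ Φ.symm) ∘ radMap η t := funext fun y => (hvy y).symm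
  refine ⟨u ∘ Φ.symm, hv, fun x hx => ?_, ?_, ?_, hc _ hv huv, fun F => ?_⟩
  · rw [Function.comp_apply, radMap_mem_tsupport_compl hΦ hx]
  · refine forall_of_forall_apply hΦ fun y => ?_
    rw [hvy]; exact h1 y
  · exact forall_of_forall_apply hΦ fun y => h2 _ hv huv y
  · rw [integral_comp_symm_eq hn hη hP hJ hΦ fun x => F ((u ∘ Φ.symm) x)]
    simp only [hvy]

end ExistsCompetitor

section SecondVariation

variable {n : ℕ} {η u v : Euc n → ℝ} {t p : ℝ}

theorem integrable_of_forall_notMem_eq_zero {g : Euc n → ℝ} (hg : AEStronglyMeasurable g)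
    {S : Set (Euc n)} (hS : IsCompact S) (h0 : ∀ x ∉ S, g x = 0) {C : ℝ} (hC : ∀ x, ‖g x‖ ≤ C) :
    Integrable g :=
  IntegrableOn.integrable_of_forall_notMem_eq_zero
    (Measure.integrableOn_of_bounded (M := C) hS.measure_lt_top.ne hg
      (Eventually.of_forall hC)) h0

theorem abs_rpow_mul_inner_le {E : Type*} [NormedAddCommGroup E] [InnerProductSpace ℝ E]
    (p : ℝ) (a b : E) : |‖a‖ ^ (p - 2) * ⟪a, b⟫| ≤ ‖a‖ ^ (p - 1) * ‖b‖ := by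
  rcases eq_or_ne a 0 with rfl | ha
  · simp; positivity
  have hn : 0 < ‖a‖ := norm_pos_iff.2 ha
  rw [show p - 1 = p - 2 + 1 by ring, Real.rpow_add_one hn.ne', abs_mul,
    abs_of_nonneg (Real.rpow_nonneg hn.le _), mul_assoc]
  gcongr
  exact abs_real_inner_le_norm a b

theorem integrable_rpow_mul_inner (hp : 1 < p) (hu : ContDiff ℝ 1 u) (huc : HasCompactSupport u)
    {g : Euc n → Euc n} (hg : Continuous g) (hgc : HasCompactSupport g) :
    Integrable fun x => ‖gradient u x‖ ^ (p - 2) * ⟪gradient u x, g x⟫ := by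
  obtain ⟨M, hM0, hM⟩ := huc.gradient.exists_norm_le hu.continuous_gradient
  obtain ⟨N, hN0, hN⟩ := hgc.exists_norm_le hg
  have m1 := hu.continuous_gradient.measurable
  have m2 := hg.measurable
  refine integrable_of_forall_notMem_eq_zero (Measurable.aestronglyMeasurable (by fun_prop)) hgc
    (fun x hx => by rw [image_eq_zero_of_notMem_tsupport hx, inner_zero_right, mul_zero])
    (C := M ^ (p - 1) * N) fun x => ?_
  refine (abs_rpow_mul_inner_le p _ _).trans ?_
  have := hM x
  have := hN x
  gcongr

theorem integrable_norm_gradient_rpow (hp : 0 < p) (hu : ContDiff ℝ 1 u)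
    (huc : HasCompactSupport u) : Integrable fun x => ‖gradient u x‖ ^ p := by
  refine Continuous.integrable_of_hasCompactSupport
    (hu.continuous_gradient.norm.rpow_const fun _ => Or.inr hp.le) ?_
  exact HasCompactSupport.intro huc fun x hx => by
    rw [gradient_eq_zero_of_notMem_tsupport hx, norm_zero, Real.zero_rpow hp.ne']

theorem gradient_sub_eq (hu : ContDiff ℝ 1 u) (hv : ContDiff ℝ 1 v) (x : Euc n) :
    gradient (fun y => v y - u y) x = gradient v x - gradient u x := by
  have h := (hv.hasGradientAt x).hasFDerivAt.sub (hu.hasGradientAt x).hasFDerivAt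
  rw [← map_sub] at h
  exact HasGradientAt.gradient (f' := gradient v x - gradient u x) h

theorem integrable_pBregman (hp : 1 < p) (hu : ContDiff ℝ 1 u) (huc : HasCompactSupport u)
    (hv : ContDiff ℝ 1 v) (hvc : HasCompactSupport v) :
    Integrable fun x => pBregman p (gradient u x) (gradient v x) :=
  (((integrable_norm_gradient_rpow (by linarith) hv hvc).div_const p).sub
    ((integrable_norm_gradient_rpow (by linarith) hu huc).div_const p)).sub
    (integrable_rpow_mul_inner hp hu huc (hv.continuous_gradient.sub hu.continuous_gradient)
      (hvc.gradient.sub huc.gradient))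

theorem integral_pBregman_eq (hp : 1 < p) (hu : ContDiff ℝ 1 u) (huc : HasCompactSupport u)
    (hv : ContDiff ℝ 1 v) (hvc : HasCompactSupport v) :
    ∫ x, pBregman p (gradient u x) (gradient v x) = (∫ x, ‖gradient v x‖ ^ p / p) -
      (∫ x, ‖gradient u x‖ ^ p / p) -
      ∫ x, ‖gradient u x‖ ^ (p - 2) * ⟪gradient u x, gradient (fun y => v y - u y) x⟫ := by
  have i1 := (integrable_norm_gradient_rpow (by linarith) hv hvc).div_const p
  have i2 := (integrable_norm_gradient_rpow (by linarith) hu huc).div_const p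
  have i3 : Integrable fun x => ‖gradient u x‖ ^ (p - 2) *
      ⟪gradient u x, gradient v x - gradient u x⟫ := integrable_rpow_mul_inner hp hu huc
    (hv.continuous_gradient.sub hu.continuous_gradient) (hvc.gradient.sub huc.gradient)
  simp_rw [gradient_sub_eq hu hv]
  have i4 : Integrable fun x => ‖gradient v x‖ ^ p / p - ‖gradient u x‖ ^ p / p := i1.sub i2
  rw [← integral_sub i1 i2, ← integral_sub i4 i3]
  rfl

/-- Soft thresholding at level `ε`. -/
def softThreshold (ε s : ℝ) : ℝ := max (s - ε) 0 - max (-s - ε) 0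

theorem abs_softThreshold_sub_le {ε : ℝ} (hε : 0 ≤ ε) (s : ℝ) : |softThreshold ε s - s| ≤ ε := by
  unfold softThreshold
  rcases max_cases (s - ε) 0 with h | h <;> rcases max_cases (-s - ε) 0 with h' | h' <;>
    rw [abs_le] <;> constructor <;> linarith

theorem softThreshold_zero {ε : ℝ} (hε : 0 ≤ ε) : softThreshold ε 0 = 0 := by
  simp [softThreshold, hε]

theorem softThreshold_of_le {ε s : ℝ} (hε : 0 ≤ ε) (h : ε ≤ s) : softThreshold ε s = s - ε := by
  rw [softThreshold, max_eq_left (by linarith), max_eq_right (by linarith), sub_zero]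

theorem softThreshold_of_le_neg {ε s : ℝ} (hε : 0 ≤ ε) (h : s ≤ -ε) :
    softThreshold ε s = s + ε := by
  rw [softThreshold, max_eq_right (by linarith), max_eq_left (by linarith)]; ring

theorem softThreshold_nonneg {ε s : ℝ} (h : -ε ≤ s) : 0 ≤ softThreshold ε s := by
  rw [softThreshold, max_eq_right (a := -s - ε) (by linarith), sub_zero]
  exact le_max_right _ _

theorem softThreshold_nonpos {ε s : ℝ} (h : s ≤ ε) : softThreshold ε s ≤ 0 := by
  rw [softThreshold, max_eq_right (a := s - ε) (by linarith), zero_sub, neg_nonpos]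
  exact le_max_right _ _

theorem exists_lipschitzWith_softThreshold {w : Euc n → ℝ} (hw : ContDiff ℝ 1 w)
    (hwc : HasCompactSupport w) (ε : ℝ) : ∃ K, LipschitzWith K fun x => softThreshold ε (w x) := by
  obtain ⟨K, hK⟩ := hw.lipschitzWith_of_hasCompactSupport hwc one_ne_zero
  exact ⟨_, ((hK.sub (LipschitzWith.const ε)).max_const 0).sub
    ((hK.neg.sub (LipschitzWith.const ε)).max_const 0)⟩

theorem gradient_softThreshold_eq_zero {w : Euc n → ℝ} (hw : Continuous w) {ε : ℝ} (hε : 0 < ε)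
    {x : Euc n} (h : |w x| ≤ ε) : gradient (fun y => softThreshold ε (w y)) x = 0 := by
  have h0 : softThreshold ε (w x) = 0 :=
    le_antisymm (softThreshold_nonpos (abs_le.1 h).2) (softThreshold_nonneg (abs_le.1 h).1)
  suffices fderiv ℝ (fun y => softThreshold ε (w y)) x = 0 by
    rw [gradient, this, map_zero]
  rcases lt_or_ge (-ε) (w x) with h1 | h1
  · refine IsLocalMin.fderiv_eq_zero ?_
    filter_upwards [hw.continuousAt.eventually (lt_mem_nhds h1)] with y hy
    rw [h0]
    exact softThreshold_nonneg hy.le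
  · refine IsLocalMax.fderiv_eq_zero ?_
    filter_upwards [hw.continuousAt.eventually (gt_mem_nhds (show w x < ε by linarith))] with y hy
    rw [h0]
    exact softThreshold_nonpos hy.le

theorem gradient_softThreshold_eq {w : Euc n → ℝ} (hw : Continuous w) {ε : ℝ} (hε : 0 < ε)
    {x : Euc n} (h : ε < |w x|) : gradient (fun y => softThreshold ε (w y)) x = gradient w x := by
  suffices fderiv ℝ (fun y => softThreshold ε (w y)) x = fderiv ℝ w x by
    rw [gradient, this, gradient]
  rcases lt_abs.1 h with h1 | h1
  · have : (fun y => softThreshold ε (w y)) =ᶠ[𝓝 x] fun y => w y - ε := by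
      filter_upwards [hw.continuousAt.eventually (lt_mem_nhds h1)] with y hy
      exact softThreshold_of_le hε.le hy.le
    rw [this.fderiv_eq, fderiv_sub_const]
  · have : (fun y => softThreshold ε (w y)) =ᶠ[𝓝 x] fun y => w y + ε := by
      filter_upwards [hw.continuousAt.eventually (gt_mem_nhds (show w x < -ε by linarith))]
        with y hy
      exact softThreshold_of_le_neg hε.le hy.le
    rw [this.fderiv_eq, fderiv_add_const]

theorem pHessian_zero_right {E : Type*} [NormedAddCommGroup E] [InnerProductSpace ℝ E] (p : ℝ)
    (a : E) : pHessian p a 0 = 0 := by simp [pHessian]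

theorem pHessian_softThreshold_le (hp : 1 < p) (hu : ContDiff ℝ 1 u) (hv : ContDiff ℝ 1 v)
    {ε : ℝ} (hε : 0 < ε) {x : Euc n}
    (h : ε < |t⁻¹ * (v x - u x)| → (1 - ε) * pHessian p (gradient u x) (gradient v x - gradient u x)
      ≤ 2 * pBregman p (gradient u x) (gradient v x)) :
    (1 - ε) * pHessian p (gradient u x)
      (gradient (fun y => softThreshold ε (t⁻¹ * (v y - u y))) x) ≤
      2 / t ^ 2 * pBregman p (gradient u x) (gradient v x) := by
  have hc : Continuous fun y => t⁻¹ * (v y - u y) :=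
    continuous_const.mul (hv.continuous.sub hu.continuous)
  rcases le_or_gt |t⁻¹ * (v x - u x)| ε with h1 | h1
  · rw [gradient_softThreshold_eq_zero hc hε h1, pHessian_zero_right, mul_zero]
    exact mul_nonneg (by positivity) (pBregman_nonneg hp _ _)
  · have e : gradient (fun y => t⁻¹ * (v y - u y)) x = t⁻¹ • (gradient v x - gradient u x) := by
      rw [← gradient_sub_eq hu hv, gradient, gradient,
        fderiv_const_mul ((hv.sub hu).differentiable one_ne_zero x)]
      simp
    rw [gradient_softThreshold_eq hc hε h1, e, pHessian_smul]
    calc _ = (t⁻¹) ^ 2 * ((1 - ε) * pHessian p (gradient u x) (gradient v x - gradient u x)) := by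
          ring
      _ ≤ (t⁻¹) ^ 2 * (2 * pBregman p (gradient u x) (gradient v x)) :=
          mul_le_mul_of_nonneg_left (h h1) (sq_nonneg _)
      _ = _ := by ring

theorem stability_le_integral_pBregman (hp : 1 < p) (hu : ContDiff ℝ 1 u)
    (huc : HasCompactSupport u) (hv : ContDiff ℝ 1 v) (hvc : HasCompactSupport v) {V : Euc n → ℝ}
    {ξ : Euc n → ℝ} {ε : ℝ} (hε : ε ≤ 1)
    (hstab : 0 ≤ (∫ x in {y | 0 < ‖gradient u y‖}, pHessian p (gradient u x) (gradient ξ x)) -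
      ∫ x, V x * ξ x ^ 2)
    (h : ∀ x, gradient u x ≠ 0 → (1 - ε) * pHessian p (gradient u x) (gradient ξ x) ≤
      2 / t ^ 2 * pBregman p (gradient u x) (gradient v x)) :
    (1 - ε) * ∫ x, V x * ξ x ^ 2 ≤
      2 / t ^ 2 * ∫ x, pBregman p (gradient u x) (gradient v x) := by
  have hm : MeasurableSet {y : Euc n | 0 < ‖gradient u y‖} :=
    measurableSet_lt measurable_const hu.continuous_gradient.measurable.norm
  have hi := (integrable_pBregman hp hu huc hv hvc).const_mul (2 / t ^ 2)
  have h0 : ∀ x, 0 ≤ 2 / t ^ 2 * pBregman p (gradient u x) (gradient v x) := fun x =>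
    mul_nonneg (by positivity) (pBregman_nonneg hp _ _)
  calc _ ≤ (1 - ε) * ∫ x in {y | 0 < ‖gradient u y‖}, pHessian p (gradient u x) (gradient ξ x) :=
        mul_le_mul_of_nonneg_left (by linarith) (by linarith)
    _ = ∫ x in {y | 0 < ‖gradient u y‖},
          (1 - ε) * pHessian p (gradient u x) (gradient ξ x) := (integral_const_mul _ _).symm
    _ ≤ ∫ x in {y | 0 < ‖gradient u y‖}, 2 / t ^ 2 * pBregman p (gradient u x) (gradient v x) := by
        refine integral_mono_of_nonneg ?_ hi.integrableOn ?_
        · filter_upwards [ae_restrict_mem hm] with x hx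
          exact mul_nonneg (by linarith) (pHessian_nonneg hp (norm_pos_iff.1 hx) _)
        · filter_upwards [ae_restrict_mem hm] with x hx
          exact h x (norm_pos_iff.1 hx)
    _ ≤ ∫ x, 2 / t ^ 2 * pBregman p (gradient u x) (gradient v x) :=
        setIntegral_le_integral hi (Eventually.of_forall h0)
    _ = _ := integral_const_mul _ _

end SecondVariation

section Core

variable {n : ℕ} {η u v : Euc n → ℝ} {t p : ℝ} {f : ℝ → ℝ}

theorem abs_integral_le_of_forall_notMem_eq_zero {g : Euc n → ℝ} {S : Set (Euc n)}
    (hS : IsCompact S) (h0 : ∀ x ∉ S, g x = 0) {C : ℝ} (hC : ∀ x, |g x| ≤ C) :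
    |∫ x, g x| ≤ C * volume.real S := by
  rw [← setIntegral_eq_integral_of_forall_compl_eq_zero h0]
  exact norm_setIntegral_le_of_norm_le_const (f := g) hS.measure_lt_top fun x _ => hC x

theorem abs_integral_mul_sq_sub_le {V ξ W : Euc n → ℝ} (hV : Continuous V) (hξ : Continuous ξ)
    (hW : Continuous W) {S : Set (Euc n)} (hS : IsCompact S) (hξ0 : ∀ x ∉ S, ξ x = 0)
    (hW0 : ∀ x ∉ S, W x = 0) {A B ε : ℝ} (hA : ∀ x ∈ S, |V x| ≤ A) (hB : ∀ x, |W x| ≤ B)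
    (hε : ε ≤ 1) (h : ∀ x, |ξ x + W x| ≤ ε) :
    |(∫ x, V x * ξ x ^ 2) - ∫ x, V x * W x ^ 2| ≤ |A| * (2 * B + 1) * volume.real S * ε := by
  have i1 : Integrable fun x => V x * ξ x ^ 2 :=
    Continuous.integrable_of_hasCompactSupport (by fun_prop)
      (HasCompactSupport.intro hS fun x hx => by simp [hξ0 x hx])
  have i2 : Integrable fun x => V x * W x ^ 2 :=
    Continuous.integrable_of_hasCompactSupport (by fun_prop)
      (HasCompactSupport.intro hS fun x hx => by simp [hW0 x hx])
  rw [← integral_sub i1 i2]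
  refine (abs_integral_le_of_forall_notMem_eq_zero hS
    (fun x hx => by simp [hξ0 x hx, hW0 x hx]) (C := |A| * (ε * (2 * B + 1)))
    fun x => ?_).trans_eq (by ring)
  have hε0 : 0 ≤ ε := (abs_nonneg _).trans (h x)
  have hB0 : 0 ≤ B := (abs_nonneg _).trans (hB x)
  by_cases hx : x ∈ S
  · have e : V x * ξ x ^ 2 - V x * W x ^ 2 = V x * ((ξ x + W x) * (ξ x - W x)) := by ring
    have h2 : |ξ x - W x| ≤ 2 * B + 1 := by
      have h1 := abs_le.1 (h x)
      have h2 := abs_le.1 (hB x)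
      rw [abs_le]
      constructor <;> linarith
    have h3 : |V x| ≤ |A| := (hA x hx).trans (le_abs_self A)
    have h4 := h x
    rw [e, abs_mul, abs_mul]
    exact mul_le_mul h3 (mul_le_mul h4 h2 (abs_nonneg _) hε0) (by positivity) (abs_nonneg A)
  · simp only [hξ0 x hx, hW0 x hx]
    norm_num
    positivity

theorem exists_abs_potential_sub_le (hf : ContDiff ℝ 1 f) (R : ℝ) {ε : ℝ} (hε : 0 < ε) :
    ∃ ρ > 0, ∀ a b : ℝ, |a| ≤ R → |b| ≤ R → |b - a| ≤ ρ →
      |(∫ s in (0 : ℝ)..b, f s) - (∫ s in (0 : ℝ)..a, f s) - f a * (b - a) -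
        deriv f a / 2 * (b - a) ^ 2| ≤ ε * (b - a) ^ 2 := by
  have hUC := (isCompact_Icc (a := -R) (b := R)).uniformContinuousOn_of_continuous
    (hf.continuous_deriv le_rfl).continuousOn
  obtain ⟨ρ, hρ, H⟩ := Metric.uniformContinuousOn_iff.1 hUC ε hε
  refine ⟨ρ / 2, half_pos hρ, fun a b ha hb hab => ?_⟩
  refine abs_sub_taylor_two_le ((convex_Icc (-R) R).inter (convex_ball a ρ))
    (F := fun y => ∫ s in (0 : ℝ)..y, f s) (f' := deriv f)
    (fun y _ => (hf.continuous.integral_hasStrictDerivAt 0 y).hasDerivAt)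
    (fun y _ => (hf.differentiable one_ne_zero y).hasDerivAt) (fun y hy => ?_)
    ⟨abs_le.1 ha, mem_ball_self hρ⟩ ⟨abs_le.1 hb, ?_⟩
  · exact (H y hy.1 a (abs_le.1 ha) hy.2).le
  · rw [mem_ball, Real.dist_eq]; linarith

theorem integral_potential_eq (hη : ContDiff ℝ 1 η)
    (hu : Continuous u) (huc : HasCompactSupport u)
    {F : ℝ → ℝ} (hF : Continuous F) (hF0 : F 0 = 0)
    (h : ∫ x, F (v x) = ∫ x, (1 + t * radDiv η x) * F (u x)) :
    (∫ x, F (v x)) - ∫ x, F (u x) = t * ∫ x, radDiv η x * F (u x) := by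
  have := hη.continuous_gradient
  have := hη.continuous
  have c1 : Continuous (radDiv η) := by unfold radDiv; fun_prop
  have c2 : Continuous fun x => F (u x) := hF.comp hu
  have s2 : HasCompactSupport fun x => F (u x) := huc.comp_left hF0
  have i1 : Integrable fun x => F (u x) := c2.integrable_of_hasCompactSupport s2
  have i2 : Integrable fun x => (1 + t * radDiv η x) * F (u x) :=
    Continuous.integrable_of_hasCompactSupport (by fun_prop) s2.mul_left
  rw [h, ← integral_const_mul, ← integral_sub i2 i1]
  congr 1 with x
  ring

theorem tsupport_subset_of_forall_notMem_eq_zero {ξ : Euc n → ℝ} {S : Set (Euc n)}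
    (hS : IsClosed S) (h : ∀ x ∉ S, ξ x = 0) : tsupport ξ ⊆ S :=
  closure_minimal (fun x hx => by_contra fun hxS => hx (h x hxS)) hS

theorem second_variation_arith {ε G C X Y D E₁ E₀ F₁ F₀ Z I c Q b m : ℝ} (ht : t ≠ 0)
    (hε : 0 ≤ ε) (hε1 : ε ≤ 1) (hC : 0 ≤ C) (hX : |X - G| ≤ C * (2 * ε)) (hY : |Y - G| ≤ C * ε)
    (hD : D = E₁ - E₀ - Z) (hF : F₁ - F₀ = t * I) (hXD : (1 - ε) * X ≤ 2 / t ^ 2 * D)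
    (hT : |(F₁ - F₀ - Z) - t ^ 2 / 2 * Y| ≤ ε * t ^ 2 * (b + 1) ^ 2 * m)
    (hE : |E₁ - E₀ - t * c - t ^ 2 / 2 * Q| ≤ ε * t ^ 2) :
    0 ≤ t * (2 * (c - I)) + t ^ 2 * Q +
      (|G| + 3 * C + 2 + 2 * ((b + 1) ^ 2 * m)) * ε * t ^ 2 := by
  have ht2 : 0 < t ^ 2 := by positivity
  have h1 : G - ε * |G| - 2 * C * ε ≤ (1 - ε) * X := by
    have h1 : G - 2 * C * ε ≤ X := by linarith [(abs_le.1 hX).1]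
    have h2 := mul_le_mul_of_nonneg_left h1 (show 0 ≤ 1 - ε by linarith)
    have h3 := mul_le_mul_of_nonneg_left (le_abs_self G) hε
    have h4 : 0 ≤ ε * (C * ε) := by positivity
    nlinarith
  have h2 : t ^ 2 * (G - ε * |G| - 2 * C * ε) ≤ 2 * D := by
    have := mul_le_mul_of_nonneg_left (h1.trans hXD) ht2.le
    refine this.trans_eq ?_
    field_simp
  have hE := (abs_le.1 hE).2
  have hY := mul_le_mul_of_nonneg_left (abs_le.1 hY).2 ht2.le
  have hT := (abs_le.1 hT).2
  nlinarith

theorem exists_eventually_second_variation_le (hn : 0 < n) (hp : 1 < p) (hf : ContDiff ℝ 1 f)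
    (hη : ContDiff ℝ 1 η) (hηc : HasCompactSupport η) (hu : ContDiff ℝ 1 u)
    (huc : HasCompactSupport u)
    (hweak : ∀ ξ : Euc n → ℝ, ContDiff ℝ 1 ξ → tsupport ξ ⊆ tsupport η →
      ∫ x, ‖gradient u x‖ ^ (p - 2) * ⟪gradient u x, gradient ξ x⟫ = ∫ x, f (u x) * ξ x)
    (hstab : ∀ ξ : Euc n → ℝ, (∃ K, LipschitzWith K ξ) → tsupport ξ ⊆ tsupport η →
      0 ≤ (∫ x in {y | 0 < ‖gradient u y‖}, pHessian p (gradient u x) (gradient ξ x)) -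
        ∫ x, deriv f (u x) * ξ x ^ 2) :
    ∃ c C : ℝ, 0 ≤ C ∧ ∀ ε, 0 < ε → ε ≤ 1 / 2 → ∀ᶠ t in 𝓝 0, 0 ≤ t * c +
      t ^ 2 * (∫ x, scaleDensity n p x (gradient u x) (gradient η x) (η x)) + C * ε * t ^ 2 := by
  obtain ⟨c, hc⟩ := exists_competitor hn hp hη hηc hu huc
  set Q := ∫ x, scaleDensity n p x (gradient u x) (gradient η x) (η x) with hQ
  set F : ℝ → ℝ := fun y => ∫ s in (0 : ℝ)..y, f s with hF
  have hFc : Continuous F := continuous_iff_continuousAt.2 fun y =>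
    (hf.continuous.integral_hasStrictDerivAt 0 y).hasDerivAt.continuousAt
  have hF0 : F 0 = 0 := by simp [F]
  have hgc := hu.continuous_gradient
  have hη0 := hη.continuous
  have hu0 := hu.continuous
  have hS : IsCompact (tsupport η) := hηc
  set W : Euc n → ℝ := fun x => η x * ⟪x, gradient u x⟫ with hW
  have hWc : Continuous W := by fun_prop
  have hW0 : ∀ x ∉ tsupport η, W x = 0 := fun x hx => by
    simp [W, image_eq_zero_of_notMem_tsupport hx]
  obtain ⟨B, hB0, hB⟩ := (HasCompactSupport.intro hS hW0).exists_norm_le hWc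
  obtain ⟨N, hN0, hN⟩ : ∃ N, 0 < N ∧ ∀ x, ‖η x • x‖ ≤ N :=
    (hηc.smul_right (f' := fun x => x)).exists_norm_le (by fun_prop)
  obtain ⟨R, hR0, hR⟩ := huc.exists_norm_le hu0
  have hV : Continuous fun x => deriv f (u x) := (hf.continuous_deriv le_rfl).comp hu0
  obtain ⟨A, hA⟩ := hS.exists_bound_of_continuousOn hV.continuousOn
  set m := volume.real (tsupport η)
  set G := ∫ x, deriv f (u x) * W x ^ 2
  set I := ∫ x, radDiv η x * F (u x)
  set C₁ := |A| * (2 * B + 1) * m with hC₁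
  have hm : 0 ≤ m := measureReal_nonneg
  have hC₁0 : 0 ≤ C₁ := by positivity
  refine ⟨2 * (c - I), |G| + 3 * C₁ + 2 + 2 * ((B + 1) ^ 2 * m), by positivity,
    fun ε hε hε1 => ?_⟩
  obtain ⟨ρ₁, hρ₁, H₁⟩ := exists_pos_pHessian_le_pBregman (E := Euc n) hp hε
  obtain ⟨ρ₂, hρ₂, H₂⟩ := exists_abs_potential_sub_le hf (R + 1) hε
  have hδ : 0 < min (ε / 2) (ρ₁ * (ε / (2 * N))) := by positivity
  have small {c : ℝ} (hc : 0 < c) : ∀ᶠ t : ℝ in 𝓝 0, |t| < c := by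
    filter_upwards [Metric.ball_mem_nhds (0 : ℝ) hc] with t ht
    simpa using ht
  filter_upwards [hc _ hδ, small (show 0 < min 1 ρ₂ / (B + 1) by positivity)]
    with t ⟨v, hv, hvu, hvW, hvg, hvE, hvF⟩ ht
  rcases eq_or_ne t 0 with rfl | ht0
  · simp
  have htp : 0 < |t| := abs_pos.2 ht0
  rw [lt_div_iff₀ (by positivity)] at ht
  have hvc : HasCompactSupport v := HasCompactSupport.intro (huc.isCompact.union hS)
    fun x hx => by
      rw [hvu x fun h => hx (Or.inr h), image_eq_zero_of_notMem_tsupport fun h => hx (Or.inl h)]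
  have hv0 := hv.continuous
  set d : Euc n → ℝ := fun x => t⁻¹ * (v x - u x) with hd
  have hdC : ContDiff ℝ 1 d := contDiff_const.mul (hv.sub hu)
  have hd0 : ∀ x ∉ tsupport η, d x = 0 := fun x hx => by simp [d, hvu x hx]
  have hdt : ∀ x, v x - u x = t * d x := fun x => by simp only [d]; field_simp
  have hdW : ∀ x, |d x + W x| ≤ ε / 2 := fun x => by
    have h := hvW x
    rw [hdt, ← mul_add, abs_mul, mul_comm] at h
    exact (le_of_mul_le_mul_right h htp).trans (min_le_left _ _)
  have hdB : ∀ x, |d x| ≤ B + 1 := fun x => by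
    have h1 := abs_le.1 (hdW x)
    have h2 := abs_le.1 (hB x)
    rw [abs_le]; constructor <;> linarith
  have hvuB : ∀ x, |v x - u x| ≤ min 1 ρ₂ := fun x => by
    rw [hdt, abs_mul]
    exact (mul_le_mul_of_nonneg_left (hdB x) htp.le).trans ht.le
  have hstab' : (1 - ε) * ∫ x, deriv f (u x) * softThreshold ε (d x) ^ 2 ≤
      2 / t ^ 2 * ∫ x, pBregman p (gradient u x) (gradient v x) := by
    have h0 : ∀ x ∉ tsupport η, softThreshold ε (d x) = 0 := fun x hx => by
      rw [hd0 x hx, softThreshold_zero hε.le]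
    refine stability_le_integral_pBregman hp hu huc hv hvc (by linarith)
      (hstab _ (exists_lipschitzWith_softThreshold hdC (HasCompactSupport.intro hS hd0) ε)
        (tsupport_subset_of_forall_notMem_eq_zero (isClosed_tsupport η) h0)) fun x hx => ?_
    refine pHessian_softThreshold_le hp hu hv hε fun hx' => H₁ _ _ hx ?_
    have h1 : ε / 2 ≤ |W x| := by
      have h1 := abs_add_le (d x + W x) (-W x)
      rw [abs_neg, add_neg_cancel_right] at h1
      have := hdW x
      change ε < |d x| at hx'
      linarith
    have h2 : |W x| ≤ N * ‖gradient u x‖ := by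
      have : W x = ⟪η x • x, gradient u x⟫ := by rw [inner_smul_left]; rfl
      rw [this]
      exact (abs_real_inner_le_norm _ _).trans (by gcongr; exact hN x)
    refine (hvg x).trans ((min_le_right _ _).trans ?_)
    gcongr
    rw [div_le_iff₀ (by positivity)]
    linarith
  have hξ := abs_integral_mul_sq_sub_le hV (ξ := fun x => softThreshold ε (d x)) (by
      have := hdC.continuous; unfold softThreshold; fun_prop) hWc hS
    (fun x hx => by simp only [hd0 x hx, softThreshold_zero hε.le]) hW0 hA hB (ε := 2 * ε)
    (by linarith) (fun x => by
      have h1 := abs_le.1 (abs_softThreshold_sub_le hε.le (d x))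
      have h2 := abs_le.1 (hdW x)
      rw [abs_le]; constructor <;> linarith)
  have hdI := abs_integral_mul_sq_sub_le hV hdC.continuous hWc hS hd0 hW0 hA hB (ε := ε)
    (by linarith) (fun x => (hdW x).trans (by linarith))
  have hD := integral_pBregman_eq hp hu huc hv hvc
  rw [hweak _ (hv.sub hu) (tsupport_subset_of_forall_notMem_eq_zero (isClosed_tsupport η)
    fun x hx => by rw [hvu x hx, sub_self])] at hD
  have hpot := integral_potential_eq hη hu0 huc hFc hF0 (hvF F)
  have c1 : Continuous fun x => f (u x) * (v x - u x) :=
    (hf.continuous.comp hu0).mul (hv0.sub hu0)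
  have i1 : Integrable fun x => f (u x) * (v x - u x) :=
    c1.integrable_of_hasCompactSupport (HasCompactSupport.mul_left (hvc.sub huc))
  have i2 : Integrable fun x => F (v x) :=
    (hFc.comp hv0).integrable_of_hasCompactSupport (hvc.comp_left hF0)
  have i3 : Integrable fun x => F (u x) :=
    (hFc.comp hu0).integrable_of_hasCompactSupport (huc.comp_left hF0)
  have i4 : Integrable fun x => deriv f (u x) * d x ^ 2 :=
    Continuous.integrable_of_hasCompactSupport (hV.mul (hdC.continuous.pow 2))
      (HasCompactSupport.intro hS fun x hx => by simp [hd0 x hx])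
  have htay : |((∫ x, F (v x)) - (∫ x, F (u x)) - ∫ x, f (u x) * (v x - u x)) -
      t ^ 2 / 2 * ∫ x, deriv f (u x) * d x ^ 2| ≤ ε * t ^ 2 * (B + 1) ^ 2 * m := by
    have i5 : Integrable fun x => F (v x) - F (u x) := i2.sub i3
    have i6 : Integrable fun x => F (v x) - F (u x) - f (u x) * (v x - u x) := i5.sub i1
    rw [← integral_sub i2 i3, ← integral_sub i5 i1, ← integral_const_mul,
      ← integral_sub i6 (i4.const_mul _)]
    refine abs_integral_le_of_forall_notMem_eq_zero hS (fun x hx => by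
      simp [hd0 x hx, hvu x hx]) fun x => ?_
    have h1 : |u x| ≤ R := hR x
    have h2 := hvuB x
    have h3 : |v x| ≤ R + 1 := by
      have := abs_add_le (v x - u x) (u x)
      rw [sub_add_cancel] at this
      have := min_le_left 1 ρ₂
      linarith
    have h4 := H₂ (u x) (v x) (by linarith) h3 (h2.trans (min_le_right _ _))
    rw [hdt] at h4 ⊢
    calc _ = |F (v x) - F (u x) - f (u x) * (t * d x) - deriv f (u x) / 2 * (t * d x) ^ 2| := by
          congr 1; ring
      _ ≤ ε * (t * d x) ^ 2 := h4
      _ = ε * t ^ 2 * |d x| ^ 2 := by rw [sq_abs]; ring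
      _ ≤ _ := by gcongr; exact hdB x
  have hE : min (ε / 2) (ρ₁ * (ε / (2 * N))) * t ^ 2 ≤ ε * t ^ 2 := by
    gcongr
    exact (min_le_left _ _).trans (by linarith)
  exact second_variation_arith ht0 hε.le (by linarith) hC₁0 hξ hdI hD hpot hstab' htay
    (hvE.trans hE)

theorem integral_scaleDensity_nonneg_of_contDiff (hn : 0 < n) (hp : 1 < p)
    (hf : ContDiff ℝ 1 f) (hη : ContDiff ℝ 1 η) (hηc : HasCompactSupport η) (hu : ContDiff ℝ 1 u)
    (huc : HasCompactSupport u)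
    (hweak : ∀ ξ : Euc n → ℝ, ContDiff ℝ 1 ξ → tsupport ξ ⊆ tsupport η →
      ∫ x, ‖gradient u x‖ ^ (p - 2) * ⟪gradient u x, gradient ξ x⟫ = ∫ x, f (u x) * ξ x)
    (hstab : ∀ ξ : Euc n → ℝ, (∃ K, LipschitzWith K ξ) → tsupport ξ ⊆ tsupport η →
      0 ≤ (∫ x in {y | 0 < ‖gradient u y‖}, pHessian p (gradient u x) (gradient ξ x)) -
        ∫ x, deriv f (u x) * ξ x ^ 2) :
    0 ≤ ∫ x, scaleDensity n p x (gradient u x) (gradient η x) (η x) := by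
  obtain ⟨c, C, hC, H⟩ :=
    exists_eventually_second_variation_le hn hp hf hη hηc hu huc hweak hstab
  set Q := ∫ x, scaleDensity n p x (gradient u x) (gradient η x) (η x)
  have key : ∀ ε, 0 < ε → ε ≤ 1 / 2 → 0 ≤ Q + C * ε := by
    intro ε hε hε1
    have h1 := H ε hε hε1
    have h2 : Tendsto (fun t : ℝ => -t) (𝓝 0) (𝓝 0) := by
      simpa using (continuous_neg (G := ℝ)).tendsto 0
    obtain ⟨t, ht, ht1, ht2⟩ := (eventually_mem_nhdsWithin.and
      ((h1.and (h2.eventually h1)).filter_mono nhdsWithin_le_nhds)).exists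
      (f := 𝓝[≠] (0 : ℝ))
    have : 0 < t ^ 2 := sq_pos_of_ne_zero ht
    rw [neg_sq] at ht2
    by_contra! hQ
    nlinarith
  by_contra! hQ
  have h := key (min (1 / 2) (-Q / (2 * (C + 1)))) (by
    have : 0 < -Q / (2 * (C + 1)) := div_pos (by linarith) (by positivity)
    positivity) (min_le_left _ _)
  have h1 := mul_le_mul_of_nonneg_left (min_le_right (1 / 2) (-Q / (2 * (C + 1)))) hC
  have h2 : C * (-Q / (2 * (C + 1))) ≤ -Q / 2 := by
    rw [mul_div_assoc', div_le_div_iff₀ (by positivity) two_pos]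
    nlinarith
  linarith

end Core

section Mollification

open scoped Convolution NNReal
open ContinuousLinearMap (lsmul)

variable {n : ℕ} {η : Euc n → ℝ} {K : ℝ≥0}

theorem norm_normed_convolution_le {F : Type*} [NormedAddCommGroup F] [NormedSpace ℝ F]
    (φ : ContDiffBump (0 : Euc n)) {g : Euc n → F} {M : ℝ} (hM : ∀ x, ‖g x‖ ≤ M) (x : Euc n) :
    ‖(φ.normed volume ⋆[lsmul ℝ ℝ, volume] g) x‖ ≤ M := by
  calc _ ≤ ∫ s, φ.normed volume s * M := by
        refine norm_integral_le_of_norm_le (φ.integrable_normed.mul_const M)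
          (Eventually.of_forall fun s => ?_)
        rw [ContinuousLinearMap.lsmul_apply, norm_smul, Real.norm_of_nonneg (φ.nonneg_normed s)]
        exact mul_le_mul_of_nonneg_left (hM _) (φ.nonneg_normed s)
    _ = M := by rw [integral_mul_const, φ.integral_normed, one_mul]

theorem normed_convolution_eq_zero (φ : ContDiffBump (0 : Euc n)) {g : Euc n → ℝ} {x : Euc n}
    (h : ∀ y ∈ ball x φ.rOut, g y = 0) :
    (φ.normed volume ⋆[lsmul ℝ ℝ, volume] g) x = 0 := by
  rw [φ.normed_convolution_eq_right fun y hy => by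
    rw [h y hy, h x (mem_ball_self φ.rOut_pos)], h x (mem_ball_self φ.rOut_pos)]

theorem LipschitzWith.hasFDerivAt_normed_convolution (hη : LipschitzWith K η)
    (φ : ContDiffBump (0 : Euc n)) (x : Euc n) :
    HasFDerivAt (φ.normed volume ⋆[lsmul ℝ ℝ, volume] η)
      ((φ.normed volume ⋆[lsmul ℝ ℝ, volume] fderiv ℝ η) x) x := by
  have hφ := φ.continuous_normed (μ := volume)
  have hmp : Measure.QuasiMeasurePreserving (fun s : Euc n => x - s) volume volume :=
    quasiMeasurePreserving_sub_left_of_right_invariant volume x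
  have hc : ∀ y : Euc n, Continuous fun s => φ.normed volume s • η (y - s) := fun y =>
    hφ.smul (hη.continuous.comp (continuous_const.sub continuous_id))
  refine (hasFDerivAt_integral_of_dominated_loc_of_lip' (𝕜 := ℝ) (μ := volume) (s := univ)
    (F := fun y s => φ.normed volume s • η (y - s))
    (F' := fun s => φ.normed volume s • fderiv ℝ η (x - s))
    (bound := fun s => φ.normed volume s * K) univ_mem
    (fun y _ => (hc y).aestronglyMeasurable)
    ((hc x).integrable_of_hasCompactSupport φ.hasCompactSupport_normed.smul_right)
    (hφ.aestronglyMeasurable.smul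
      ((measurable_fderiv ℝ η).comp (measurable_const.sub measurable_id)).aestronglyMeasurable)
    (Eventually.of_forall fun s y _ => ?_) (φ.integrable_normed.mul_const _) ?_).2
  · rw [← smul_sub, norm_smul, Real.norm_of_nonneg (φ.nonneg_normed s), mul_assoc]
    refine mul_le_mul_of_nonneg_left ?_ (φ.nonneg_normed s)
    simpa [dist_eq_norm] using hη.dist_le_mul (y - s) (x - s)
  · filter_upwards [hmp.ae hη.ae_differentiableAt] with s hs
    exact ((hasFDerivAt_comp_sub s).2 hs.hasFDerivAt).const_smul (φ.normed volume s)

theorem LipschitzWith.exists_smooth_approx (hη : LipschitzWith K η) (hηc : HasCompactSupport η)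
    {r' r : ℝ} (hr : r' < r) (hs : tsupport η ⊆ ball 0 r') :
    ∃ ζ : ℕ → Euc n → ℝ, (∀ k, ContDiff ℝ 1 (ζ k)) ∧ (∀ k, ∀ x ∉ closedBall 0 r, ζ k x = 0) ∧
      (∀ x, Tendsto (fun k => ζ k x) atTop (𝓝 (η x))) ∧
      (∀ᵐ x, Tendsto (fun k => gradient (ζ k) x) atTop (𝓝 (gradient η x))) ∧
      (∀ k x, ‖gradient (ζ k) x‖ ≤ K) ∧ ∃ M, ∀ k x, |ζ k x| ≤ M := by
  obtain ⟨M, -, hM⟩ := hηc.exists_norm_le hη.continuous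
  have hd : 0 < r - r' := sub_pos.2 hr
  let φ : ℕ → ContDiffBump (0 : Euc n) := fun k =>
    ⟨(r - r') / (k + 1) / 2, (r - r') / (k + 1), by positivity, half_lt_self (by positivity)⟩
  have hφ0 : Tendsto (fun k => (φ k).rOut) atTop (𝓝 0) := by
    have := tendsto_one_div_add_atTop_nhds_zero_nat.const_mul (r - r')
    simpa [φ, div_eq_mul_inv] using this
  have hφ1 : ∀ k, (φ k).rOut ≤ r - r' := fun k => div_le_self hd.le (by simp)
  have hgrad : ∀ k x, gradient ((φ k).normed volume ⋆[lsmul ℝ ℝ, volume] η) x =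
      (InnerProductSpace.toDual ℝ (Euc n)).symm
        (((φ k).normed volume ⋆[lsmul ℝ ℝ, volume] fderiv ℝ η) x) := fun k x => by
    rw [gradient, (hη.hasFDerivAt_normed_convolution (φ k) x).fderiv]
  have hK : ∀ x, ‖fderiv ℝ η x‖ ≤ K := fun x => norm_fderiv_le_of_lipschitz ℝ hη
  have hloc : LocallyIntegrable (fderiv ℝ η) :=
    (locallyIntegrable_const (K : ℝ)).mono (measurable_fderiv ℝ η).aestronglyMeasurable
      (Eventually.of_forall fun x => (hK x).trans (le_abs_self _))
  refine ⟨fun k => (φ k).normed volume ⋆[lsmul ℝ ℝ, volume] η, fun k => ?_, fun k x hx => ?_,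
    fun x => ContDiffBump.convolution_tendsto_right_of_continuous hφ0 hη.continuous x, ?_,
    fun k x => ?_, M, fun k x => norm_normed_convolution_le _ hM x⟩
  · exact (φ k).hasCompactSupport_normed.contDiff_convolution_left _ (φ k).contDiff_normed
      hη.continuous.locallyIntegrable
  · refine normed_convolution_eq_zero _ fun y hy => image_eq_zero_of_notMem_tsupport fun h => hx ?_
    have h1 := hs h
    have h2 := hφ1 k
    rw [mem_ball, dist_comm] at hy
    rw [mem_ball] at h1
    rw [mem_closedBall]
    linarith [dist_triangle x y 0]
  · have := ContDiffBump.ae_convolution_tendsto_right_of_locallyIntegrable (K := 2) hφ0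
      (Eventually.of_forall fun k => by simp only [φ]; linarith) hloc
    filter_upwards [this] with x hx
    simp only [hgrad]
    exact ((InnerProductSpace.toDual ℝ (Euc n)).symm.continuous.tendsto _).comp hx
  · rw [hgrad, LinearIsometryEquiv.norm_map]
    exact norm_normed_convolution_le _ hK x

end Mollification

section LipschitzProfile

open scoped NNReal

variable {n : ℕ} {η u : Euc n → ℝ} {p : ℝ}

theorem abs_mul_inner_le_norm_rpow (p a : ℝ) (x z v : Euc n) :
    |‖z‖ ^ p * (2 * a * ⟪x, v⟫)| ≤ ‖z‖ ^ p * (2 * |a| * (‖x‖ * ‖v‖)) := by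
  rw [abs_mul, abs_of_nonneg (Real.rpow_nonneg (norm_nonneg z) p), abs_mul, abs_mul, abs_two]
  gcongr
  exact abs_real_inner_le_norm x v

theorem abs_inner_mul_inner_le_norm_rpow (p : ℝ) (x z v : Euc n) :
    |⟪x, z⟫ * ‖z‖ ^ (p - 2) * ⟪z, v⟫| ≤ ‖z‖ ^ p * (‖x‖ * ‖v‖) := by
  rcases eq_or_ne z 0 with rfl | hz
  · simp; positivity
  have hn : 0 < ‖z‖ := norm_pos_iff.2 hz
  rw [mul_assoc, abs_mul]
  calc _ ≤ ‖x‖ * ‖z‖ * (‖z‖ ^ (p - 1) * ‖v‖) := by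
        gcongr
        · exact abs_real_inner_le_norm x z
        · exact abs_rpow_mul_inner_le p z v
    _ = ‖z‖ ^ (p - 1 + 1) * (‖x‖ * ‖v‖) := by rw [Real.rpow_add_one hn.ne']; ring
    _ = _ := by rw [sub_add_cancel]

theorem abs_inner_sq_mul_le_norm_rpow (p : ℝ) (x z v : Euc n) :
    |⟪x, z⟫ ^ 2 * (‖z‖ ^ (p - 2) * ‖v‖ ^ 2 + (p - 2) * ‖z‖ ^ (p - 4) * ⟪v, z⟫ ^ 2)| ≤
      ‖z‖ ^ p * ((1 + |p - 2|) * (‖x‖ * ‖v‖) ^ 2) := by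
  rcases eq_or_ne z 0 with rfl | hz
  · simp; positivity
  have hn : 0 < ‖z‖ := norm_pos_iff.2 hz
  have e2 : ‖z‖ ^ (p - 2) = ‖z‖ ^ (p - 4) * ‖z‖ ^ 2 := by
    rw [← Real.rpow_natCast, ← Real.rpow_add hn]; congr 1; push_cast; ring
  have e4 : ‖z‖ ^ p = ‖z‖ ^ (p - 4) * ‖z‖ ^ 2 * ‖z‖ ^ 2 := by
    rw [← e2, ← Real.rpow_natCast, ← Real.rpow_add hn]; congr 1; push_cast; ring
  have h1 : ⟪x, z⟫ ^ 2 ≤ (‖x‖ * ‖z‖) ^ 2 := sq_le_sq.2 <| by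
    simpa [abs_mul] using abs_real_inner_le_norm x z
  have h2 : ⟪v, z⟫ ^ 2 ≤ (‖v‖ * ‖z‖) ^ 2 := sq_le_sq.2 <| by
    simpa [abs_mul] using abs_real_inner_le_norm v z
  have h4 : 0 ≤ ‖z‖ ^ (p - 4) := Real.rpow_nonneg hn.le _
  rw [abs_mul, abs_of_nonneg (sq_nonneg _), e2]
  calc _ ≤ (‖x‖ * ‖z‖) ^ 2 * (‖z‖ ^ (p - 4) * ‖z‖ ^ 2 * ‖v‖ ^ 2 +
        |p - 2| * ‖z‖ ^ (p - 4) * (‖v‖ * ‖z‖) ^ 2) := by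
        gcongr
        refine (abs_add_le _ _).trans (add_le_add (abs_of_nonneg (by positivity)).le ?_)
        rw [abs_mul, abs_mul, abs_of_nonneg h4, abs_of_nonneg (sq_nonneg ⟪v, z⟫)]
        gcongr
    _ = _ := by rw [e4]; ring

theorem abs_scaleDensity_le (p a : ℝ) (x z v : Euc n) :
    |scaleDensity n p x z v a| ≤ ‖z‖ ^ p * (|p - n| * |a| ^ 2 + 2 * |a| * (‖x‖ * ‖v‖) +
      2 * |p| * |a| * (‖x‖ * ‖v‖) + (1 + |p - 2|) * (‖x‖ * ‖v‖) ^ 2) := by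
  have e : scaleDensity n p x z v a = (p - n) * (‖z‖ ^ p * a ^ 2) - ‖z‖ ^ p * (2 * a * ⟪x, v⟫) +
      2 * p * a * (⟪x, z⟫ * ‖z‖ ^ (p - 2) * ⟪z, v⟫) +
      ⟪x, z⟫ ^ 2 * (‖z‖ ^ (p - 2) * ‖v‖ ^ 2 + (p - 2) * ‖z‖ ^ (p - 4) * ⟪v, z⟫ ^ 2) := by
    rw [scaleDensity]; ring
  have h2 : |2 * p * a * (⟪x, z⟫ * ‖z‖ ^ (p - 2) * ⟪z, v⟫)| ≤
      2 * |p| * |a| * (‖z‖ ^ p * (‖x‖ * ‖v‖)) := by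
    rw [abs_mul, abs_mul, abs_mul, abs_two]
    gcongr
    exact abs_inner_mul_inner_le_norm_rpow p x z v
  have h3 : |(p - n) * (‖z‖ ^ p * a ^ 2)| = |p - n| * (‖z‖ ^ p * |a| ^ 2) := by
    rw [abs_mul, abs_mul, abs_of_nonneg (Real.rpow_nonneg (norm_nonneg z) p), abs_pow]
  rw [e]
  calc _ ≤ |p - n| * (‖z‖ ^ p * |a| ^ 2) + ‖z‖ ^ p * (2 * |a| * (‖x‖ * ‖v‖)) +
        2 * |p| * |a| * (‖z‖ ^ p * (‖x‖ * ‖v‖)) +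
        ‖z‖ ^ p * ((1 + |p - 2|) * (‖x‖ * ‖v‖) ^ 2) := by
        refine (abs_add_le _ _).trans (add_le_add ((abs_add_le _ _).trans (add_le_add
          ((abs_sub _ _).trans (add_le_add h3.le (abs_mul_inner_le_norm_rpow p a x z v))) h2))
          (abs_inner_sq_mul_le_norm_rpow p x z v))
    _ = _ := by ring

theorem measurable_gradient (g : Euc n → ℝ) : Measurable (gradient g) :=
  (InnerProductSpace.toDual ℝ (Euc n)).symm.continuous.measurable.comp (measurable_fderiv ℝ g)

theorem LipschitzWith.norm_gradient_le {K : ℝ≥0} {g : Euc n → ℝ} (hg : LipschitzWith K g)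
    (x : Euc n) : ‖gradient g x‖ ≤ K := by
  rw [gradient, LinearIsometryEquiv.norm_map]
  exact norm_fderiv_le_of_lipschitz ℝ hg

theorem scaleDensity_zero_zero (p : ℝ) (x z : Euc n) : scaleDensity n p x z 0 0 = 0 := by
  simp [scaleDensity]

/-- It suffices to test nonnegativity of the scaling functional on smooth profiles. -/
theorem integral_scaleDensity_nonneg_of_lipschitz (hp : 0 < p) (hu : ContDiff ℝ 1 u)
    (huc : HasCompactSupport u) (hη : ∃ K, LipschitzWith K η) (hηc : HasCompactSupport η)
    {r' r : ℝ} (hr : r' < r) (hs : tsupport η ⊆ ball 0 r')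
    (h : ∀ ζ : Euc n → ℝ, ContDiff ℝ 1 ζ → tsupport ζ ⊆ closedBall 0 r →
      0 ≤ ∫ x, scaleDensity n p x (gradient u x) (gradient ζ x) (ζ x)) :
    0 ≤ ∫ x, scaleDensity n p x (gradient u x) (gradient η x) (η x) := by
  obtain ⟨K, hη⟩ := hη
  obtain ⟨ζ, h1, h2, h3, h4, h5, M, h6⟩ := hη.exists_smooth_approx hηc hr hs
  obtain ⟨N, -, hN⟩ := huc.gradient.exists_norm_le hu.continuous_gradient
  have hts : ∀ k, tsupport (ζ k) ⊆ closedBall 0 r := fun k =>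
    tsupport_subset_of_forall_notMem_eq_zero isClosed_closedBall (h2 k)
  set C : ℝ := N ^ p * (|p - n| * M ^ 2 + 2 * M * (r * K) +
    2 * |p| * M * (r * K) + (1 + |p - 2|) * (r * K) ^ 2)
  refine ge_of_tendsto' (tendsto_integral_of_dominated_convergence
    ((closedBall (0 : Euc n) r).indicator fun _ => C) (fun k => ?_) ?_ (fun k => ?_) ?_)
    fun k => h (ζ k) (h1 k) (hts k)
  · have m1 := measurable_gradient u
    have m2 := measurable_gradient (ζ k)
    have m3 := (h1 k).continuous.measurable
    unfold scaleDensity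
    exact Measurable.aestronglyMeasurable (by fun_prop)
  · exact (integrable_indicator_iff measurableSet_closedBall).2
      (integrableOn_const (isCompact_closedBall _ _).measure_lt_top.ne)
  · refine Eventually.of_forall fun x => ?_
    by_cases hx : x ∈ closedBall 0 r
    · rw [indicator_of_mem hx]
      have hx' : ‖x‖ ≤ r := mem_closedBall_zero_iff.1 hx
      have hr0 : 0 ≤ r := (norm_nonneg x).trans hx'
      have hM0 : 0 ≤ M := (abs_nonneg _).trans (h6 k x)
      refine (abs_scaleDensity_le p _ _ _ _).trans ?_
      have hN0 : 0 ≤ N := (norm_nonneg _).trans (hN x)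
      have := hN x
      have := h5 k x
      have := h6 k x
      simp only [C]
      gcongr
    · rw [indicator_of_notMem hx, h2 k x hx,
        gradient_eq_zero_of_notMem_tsupport fun h => hx (hts k h), scaleDensity_zero_zero,
        norm_zero]
  · filter_upwards [h4] with x hx
    have hc : Continuous fun y : Euc n × ℝ => scaleDensity n p x (gradient u x) y.1 y.2 := by
      unfold scaleDensity
      fun_prop
    have ht : Tendsto (fun k => (gradient (ζ k) x, ζ k x)) atTop (𝓝 (gradient η x, η x)) :=
      hx.prodMk_nhds (h3 x)
    have := (hc.tendsto (gradient η x, η x)).comp ht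
    exact this

end LipschitzProfile

section Localization

variable {n : ℕ} {f : ℝ → ℝ} {η u w : Euc n → ℝ} {p : ℝ}

theorem exists_contDiff_hasCompactSupport_eqOn_ball (hu : ContDiffOn ℝ 1 u (ball 0 1)) {s : ℝ}
    (hs0 : 0 < s) (hs1 : s < 1) :
    ∃ w, ContDiff ℝ 1 w ∧ HasCompactSupport w ∧ EqOn w u (ball 0 s) := by
  obtain ⟨R, hsR, hR⟩ := exists_between hs1
  let χ : ContDiffBump (0 : Euc n) := ⟨s, R, hs0, hsR⟩
  refine ⟨fun x => χ x * u x, contDiff_iff_contDiffAt.2 fun x => ?_,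
    χ.hasCompactSupport.mul_right, fun x hx => ?_⟩
  · by_cases hx : x ∈ ball (0 : Euc n) 1
    · exact χ.contDiff.contDiffAt.mul (hu.contDiffAt (isOpen_ball.mem_nhds hx))
    · refine contDiffAt_const (c := (0 : ℝ)) |>.congr_of_eventuallyEq ?_
      have hx' : x ∉ tsupport χ := fun h => hx <|
        closedBall_subset_ball hR (χ.tsupport_eq ▸ h)
      filter_upwards [notMem_tsupport_iff_eventuallyEq.1 hx'] with y hy
      rw [hy, Pi.zero_apply, zero_mul]
  · change χ x * u x = u x
    rw [χ.one_of_mem_closedBall (ball_subset_closedBall hx), one_mul]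

theorem setIntegral_eq_integral_of_ae_eq {F G : Euc n → ℝ} {S U : Set (Euc n)} (hSU : S ⊆ U)
    (hF : ∀ x ∉ S, F x = 0) (hG : ∀ x ∉ S, G x = 0) (h : ∀ᵐ x, x ∈ S → G x = F x) :
    ∫ x in U, G x = ∫ x, F x := by
  rw [setIntegral_eq_integral_of_forall_compl_eq_zero fun x hx => hG x fun h => hx (hSU h)]
  refine integral_congr_ae ?_
  filter_upwards [h] with x hx
  by_cases hxS : x ∈ S
  · exact hx hxS
  · rw [hF x hxS, hG x hxS]

theorem IsStableRegularSolution.integral_scaleDensity_nonneg (hp : 1 < p) (hf : ContDiff ℝ 1 f)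
    (hu : IsStableRegularSolution n p (ball 0 1) f u) (hw : ContDiff ℝ 1 w)
    (hwc : HasCompactSupport w) {r' r s : ℝ} (hr : r' < r) (hrs : r < s) (hs : s < 1)
    (hwu : EqOn w u (ball 0 s)) (hη : ∃ K, LipschitzWith K η) (hηc : HasCompactSupport η)
    (hηs : tsupport η ⊆ ball 0 r') :
    0 ≤ ∫ x, scaleDensity n p x (gradient w x) (gradient η x) (η x) := by
  rcases Nat.eq_zero_or_pos n with rfl | hn
  · refine integral_nonneg fun x => ?_
    rw [Subsingleton.elim (gradient w x) 0, Subsingleton.elim x 0]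
    simp [scaleDensity, Real.zero_rpow (by linarith : p ≠ 0)]
  refine integral_scaleDensity_nonneg_of_lipschitz (by linarith) hw hwc hη hηc hr hηs
    fun ζ hζ hζs => ?_
  have hSU : closedBall (0 : Euc n) r ⊆ ball 0 1 := closedBall_subset_ball (hrs.trans hs)
  have hS : ∀ x ∈ closedBall (0 : Euc n) r, u x = w x ∧ gradient u x = gradient w x := by
    intro x hx
    have hx' := closedBall_subset_ball hrs hx
    exact ⟨(hwu hx').symm, (hwu.eventuallyEq_of_mem (isOpen_ball.mem_nhds hx')).symm.gradient_eq⟩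
  have hcomp : ∀ ξ : Euc n → ℝ, tsupport ξ ⊆ closedBall 0 r → HasCompactSupport ξ := fun ξ h =>
    (isCompact_closedBall _ _).of_isClosed_subset (isClosed_tsupport ξ) h
  have h0 : ∀ ξ : Euc n → ℝ, tsupport ξ ⊆ closedBall 0 r → ∀ x ∉ closedBall (0 : Euc n) r,
      ξ x = 0 ∧ gradient ξ x = 0 := fun ξ h x hx =>
    ⟨image_eq_zero_of_notMem_tsupport fun h' => hx (h h'),
      gradient_eq_zero_of_notMem_tsupport fun h' => hx (h h')⟩
  refine integral_scaleDensity_nonneg_of_contDiff hn hp hf hζ (hcomp ζ hζs) hw hwc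
    (fun ξ hξ hξs => ?_) fun ξ hξ hξs => ?_
  · have hξS := hξs.trans hζs
    have h := hu.1.2.2 ξ hξ (hcomp ξ hξS) (hξS.trans hSU)
    rwa [setIntegral_eq_integral_of_ae_eq hSU
        (F := fun x => ‖gradient w x‖ ^ (p - 2) * ⟪gradient w x, gradient ξ x⟫)
        (fun x hx => by simp [h0 ξ hξS x hx]) (fun x hx => by simp [h0 ξ hξS x hx])
        (Eventually.of_forall fun x hx => by simp only [hS x hx]),
      setIntegral_eq_integral_of_ae_eq hSU (F := fun x => f (w x) * ξ x)
        (fun x hx => by simp [h0 ξ hξS x hx]) (fun x hx => by simp [h0 ξ hξS x hx])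
        (Eventually.of_forall fun x hx => by simp only [hS x hx])] at h
  · have hξS := hξs.trans hζs
    have h := hu.2 ξ hξ (hcomp ξ hξS) (hξS.trans hSU)
    have hm : ∀ g : Euc n → ℝ, MeasurableSet {y | 0 < ‖gradient g y‖} := fun g =>
      measurableSet_lt measurable_const (measurable_gradient g).norm
    change 0 ≤ (∫ x in ball 0 1 ∩ {y | 0 < ‖gradient u y‖},
      pHessian p (gradient u x) (gradient ξ x)) - _ at h
    rw [← setIntegral_indicator (hm u), setIntegral_eq_integral_of_ae_eq hSU
        (F := {y | 0 < ‖gradient w y‖}.indicator fun x => pHessian p (gradient w x) (gradient ξ x))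
        ?_ ?_ (Eventually.of_forall fun x hx => ?_), integral_indicator (hm w),
      setIntegral_eq_integral_of_ae_eq hSU (F := fun x => deriv f (w x) * ξ x ^ 2)
        (fun x hx => by simp [h0 ξ hξS x hx]) (fun x hx => by simp [h0 ξ hξS x hx])
        (Eventually.of_forall fun x hx => by simp only [hS x hx])] at h
    · exact h
    · exact fun x hx => indicator_apply_eq_zero.2 fun _ => by
        rw [(h0 ξ hξS x hx).2, pHessian_zero_right]
    · exact fun x hx => indicator_apply_eq_zero.2 fun _ => by
        rw [(h0 ξ hξS x hx).2, pHessian_zero_right]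
    · simp only [indicator_apply, mem_ofPred_eq, hS x hx]

theorem norm_mul_radialDeriv (g : Euc n → ℝ) (x : Euc n) :
    ‖x‖ * radialDeriv g x = ⟪x, gradient g x⟫ := by
  rcases eq_or_ne x 0 with rfl | hx
  · simp
  · rw [radialDeriv, mul_div_cancel₀ _ (norm_ne_zero_iff.2 hx)]

theorem gradient_sq_eq {x : Euc n} (h : DifferentiableAt ℝ η x) :
    gradient (fun y => η y ^ 2) x = (2 * η x) • gradient η x := by
  rw [gradient, (h.hasFDerivAt.pow 2).fderiv, gradient]
  simp

/-- Separation of `scaleDensity` into the terms of the weighted gradient estimate. -/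
theorem integral_scaleDensity_eq (hp : 0 < p) (hw : ContDiff ℝ 1 w) (hwc : HasCompactSupport w)
    (hη : ∃ K, LipschitzWith K η) (hηc : HasCompactSupport η) :
    ∫ x, scaleDensity n p x (gradient w x) (gradient η x) (η x) =
      -(∫ x, ‖gradient w x‖ ^ p * (2 * η x * ⟪x, gradient η x⟫)) +
        p * (∫ x, 2 * η x * (⟪x, gradient w x⟫ * ‖gradient w x‖ ^ (p - 2) *
          ⟪gradient w x, gradient η x⟫)) +
        (p - n) * (∫ x, ‖gradient w x‖ ^ p * η x ^ 2) +
        ∫ x, ⟪x, gradient w x⟫ ^ 2 * (‖gradient w x‖ ^ (p - 2) * ‖gradient η x‖ ^ 2 +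
          (p - 2) * ‖gradient w x‖ ^ (p - 4) * ⟪gradient η x, gradient w x⟫ ^ 2) := by
  obtain ⟨K, hη⟩ := hη
  obtain ⟨M, hM0, hM⟩ := hηc.exists_norm_le hη.continuous
  obtain ⟨N, hN0, hN⟩ := hwc.gradient.exists_norm_le hw.continuous_gradient
  obtain ⟨R, hR⟩ := hηc.exists_bound_of_continuousOn (f := fun x : Euc n => x) continuousOn_id
  have hK := hη.norm_gradient_le
  have m1 := measurable_gradient w
  have m2 := measurable_gradient η
  have m3 := hη.continuous.measurable
  have hz : ∀ x ∉ tsupport η, η x = 0 ∧ gradient η x = 0 := fun x hx =>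
    ⟨image_eq_zero_of_notMem_tsupport hx, gradient_eq_zero_of_notMem_tsupport hx⟩
  have key : ∀ {g : Euc n → ℝ}, Measurable g → (∀ x ∉ tsupport η, g x = 0) → ∀ {C : ℝ},
      (∀ x ∈ tsupport η, |g x| ≤ N ^ p * C) → Integrable g := fun {g} hg h0 {C} hC =>
    integrable_of_forall_notMem_eq_zero hg.aestronglyMeasurable hηc h0
      (C := max (N ^ p * C) 0) fun x => by
        by_cases hx : x ∈ tsupport η
        · exact (hC x hx).trans (le_max_left _ _)
        · rw [h0 x hx, norm_zero]; exact le_max_right _ _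
  have i1 : Integrable fun x => ‖gradient w x‖ ^ p * (2 * η x * ⟪x, gradient η x⟫) := by
    refine key (by fun_prop) (fun x hx => by simp [hz x hx]) (C := 2 * M * (R * K)) fun x hx => ?_
    have := hN x
    have := hR x hx
    have := hK x
    have := hM x
    have := (norm_nonneg x).trans ‹‖x‖ ≤ R›
    refine (abs_mul_inner_le_norm_rpow p _ _ _ _).trans ?_
    gcongr
    exact hM x
  have i2 : Integrable fun x => 2 * η x * (⟪x, gradient w x⟫ * ‖gradient w x‖ ^ (p - 2) *
      ⟪gradient w x, gradient η x⟫) := by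
    refine key (by fun_prop) (fun x hx => by simp [hz x hx]) (C := 2 * M * (R * K)) fun x hx => ?_
    have := hN x
    have := hR x hx
    have := hK x
    have := (norm_nonneg x).trans ‹‖x‖ ≤ R›
    rw [abs_mul, abs_mul, abs_two]
    calc _ ≤ 2 * M * (N ^ p * (R * K)) := by
          gcongr
          · exact hM x
          · refine (abs_inner_mul_inner_le_norm_rpow p _ _ _).trans ?_
            gcongr
      _ = _ := by ring
  have i3 : Integrable fun x => ‖gradient w x‖ ^ p * η x ^ 2 := by
    refine key (by fun_prop) (fun x hx => by simp [hz x hx]) (C := M ^ 2) fun x hx => ?_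
    have := hN x
    rw [abs_mul, abs_of_nonneg (by positivity), abs_pow]
    gcongr
    exact hM x
  have i4 : Integrable fun x => ⟪x, gradient w x⟫ ^ 2 *
      (‖gradient w x‖ ^ (p - 2) * ‖gradient η x‖ ^ 2 +
          (p - 2) * ‖gradient w x‖ ^ (p - 4) * ⟪gradient η x, gradient w x⟫ ^ 2) := by
    refine key (by fun_prop) (fun x hx => by simp [hz x hx])
      (C := (1 + |p - 2|) * (R * K) ^ 2) fun x hx => ?_
    have := hN x
    have := hR x hx
    have := hK x
    have := (norm_nonneg x).trans ‹‖x‖ ≤ R›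
    refine (abs_inner_sq_mul_le_norm_rpow p _ _ _).trans ?_
    gcongr
  have e : ∀ x, scaleDensity n p x (gradient w x) (gradient η x) (η x) =
      -(‖gradient w x‖ ^ p * (2 * η x * ⟪x, gradient η x⟫)) +
        p * (2 * η x * (⟪x, gradient w x⟫ * ‖gradient w x‖ ^ (p - 2) *
          ⟪gradient w x, gradient η x⟫)) + (p - n) * (‖gradient w x‖ ^ p * η x ^ 2) +
        ⟪x, gradient w x⟫ ^ 2 * (‖gradient w x‖ ^ (p - 2) * ‖gradient η x‖ ^ 2 +
          (p - 2) * ‖gradient w x‖ ^ (p - 4) * ⟪gradient η x, gradient w x⟫ ^ 2) := fun x => by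
    rw [scaleDensity]; ring
  simp_rw [e]
  have j2 := i1.fun_neg.fun_add (i2.const_mul p)
  have j3 := j2.fun_add (i3.const_mul (p - n))
  rw [integral_add j3 i4, integral_add j2 (i3.const_mul _), integral_add i1.fun_neg
    (i2.const_mul p), integral_neg, integral_const_mul, integral_const_mul]

end Localization

end Preparation

/-- Lemma 2.4: for a stable regular solution `u` of `−Δ_p u = f(u)` in `B₁`
and any Lipschitz `η` with compact support in `B₁`,
`∫ 2|∇u|^p r η_r η − p ∫ r u_r |∇u|^{p−2} ∇u·∇(η²) + (n−p) ∫ |∇u|^p η²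
  ≤ ∫ r² u_r² (|∇u|^{p−2}|∇η|² + (p−2)|∇u|^{p−4}(∇η·∇u)²)`,
all integrals over `B₁`. -/
theorem statement2 (n : ℕ) (p : ℝ) (hp : 1 < p)
    (f : ℝ → ℝ) (hf : ContDiff ℝ 1 f) (u : Euc n → ℝ)
    (hu : IsStableRegularSolution n p (ball 0 1) f u)
    (η : Euc n → ℝ) (hη : ∃ K, LipschitzWith K η)
    (hηc : HasCompactSupport η) (hηs : tsupport η ⊆ ball (0 : Euc n) 1) :
    (∫ x in ball (0 : Euc n) 1,
        2 * ‖gradient u x‖ ^ p * ‖x‖ * radialDeriv η x * η x)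
      - p * (∫ x in ball (0 : Euc n) 1,
          ‖x‖ * radialDeriv u x * ‖gradient u x‖ ^ (p - 2) *
            ⟪gradient u x, gradient (fun y => η y ^ 2) x⟫)
      + (n - p) * (∫ x in ball (0 : Euc n) 1, ‖gradient u x‖ ^ p * η x ^ 2)
      ≤ ∫ x in ball (0 : Euc n) 1,
          ‖x‖ ^ 2 * radialDeriv u x ^ 2 *
            (‖gradient u x‖ ^ (p - 2) * ‖gradient η x‖ ^ 2
              + (p - 2) * ‖gradient u x‖ ^ (p - 4) *
                  ⟪gradient η x, gradient u x⟫ ^ 2) := by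
  obtain ⟨r', hr', hr's⟩ := exists_lt_subset_ball (isClosed_tsupport η) hηs
  obtain ⟨r, hr'r, hr⟩ := exists_between (max_lt hr' one_pos)
  obtain ⟨s, hrs, hs⟩ := exists_between hr
  obtain ⟨w, hw, hwc, hwu⟩ := exists_contDiff_hasCompactSupport_eqOn_ball hu.1.1
    (((le_max_right _ _).trans_lt hr'r).trans hrs) hs
  have hmain := hu.integral_scaleDensity_nonneg hp hf hw hwc ((le_max_left _ _).trans_lt hr'r)
    hrs hs hwu hη hηc hr's
  rw [integral_scaleDensity_eq (by linarith) hw hwc hη hηc] at hmain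
  have hz : ∀ x ∉ tsupport η,
      η x = 0 ∧ gradient η x = 0 ∧ gradient (fun y => η y ^ 2) x = 0 := fun x hx =>
    ⟨image_eq_zero_of_notMem_tsupport hx, gradient_eq_zero_of_notMem_tsupport hx,
      gradient_eq_zero_of_notMem_tsupport fun h => hx <| tsupport_subset_of_forall_notMem_eq_zero
        (isClosed_tsupport η) (fun y hy => by simp [image_eq_zero_of_notMem_tsupport hy]) h⟩
  have hg : ∀ x ∈ tsupport η, gradient u x = gradient w x := fun x hx =>
    (hwu.eventuallyEq_of_mem (isOpen_ball.mem_nhds (ball_subset_ball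
      ((le_max_left _ _).trans (hr'r.trans hrs).le) (hr's hx)))).symm.gradient_eq
  have hd : ∀ᵐ x, DifferentiableAt ℝ η x := hη.choose_spec.ae_differentiableAt
  rw [setIntegral_eq_integral_of_ae_eq hηs
      (F := fun x => ‖gradient w x‖ ^ p * (2 * η x * ⟪x, gradient η x⟫))
      (fun x hx => by simp [hz x hx]) (fun x hx => by simp [hz x hx])
      (Eventually.of_forall fun x hx => by rw [hg x hx, ← norm_mul_radialDeriv]; ring),
    setIntegral_eq_integral_of_ae_eq hηs
      (F := fun x => 2 * η x * (⟪x, gradient w x⟫ * ‖gradient w x‖ ^ (p - 2) *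
          ⟪gradient w x, gradient η x⟫))
      (fun x hx => by simp [hz x hx]) (fun x hx => by simp [hz x hx])
      (hd.mono fun x hdx hx => by
        rw [norm_mul_radialDeriv, hg x hx, gradient_sq_eq hdx, real_inner_smul_right]; ring),
    setIntegral_eq_integral_of_ae_eq hηs (F := fun x => ‖gradient w x‖ ^ p * η x ^ 2)
      (fun x hx => by simp [hz x hx]) (fun x hx => by simp [hz x hx])
      (Eventually.of_forall fun x hx => by rw [hg x hx]),
    setIntegral_eq_integral_of_ae_eq hηs (F := fun x => ⟪x, gradient w x⟫ ^ 2 *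
        (‖gradient w x‖ ^ (p - 2) * ‖gradient η x‖ ^ 2 +
          (p - 2) * ‖gradient w x‖ ^ (p - 4) * ⟪gradient η x, gradient w x⟫ ^ 2))
      (fun x hx => by simp [hz x hx]) (fun x hx => by simp [hz x hx])
      (Eventually.of_forall fun x hx => by rw [← mul_pow, norm_mul_radialDeriv, hg x hx])]
  linarith
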